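/- Let y ∈ X+ ⊗ t_λ ⊗ X− and suppose that y* is extremal. Then there exist l ≥ 0 and indices i_1, …, i_l ∈ I such that f̃_{i_l} ⋯ f̃_{i_1}(y) ∈ Σ'_ι[λ]. -/

import Mathlib

open Filter Function

namespace HypCrystal

variable (a1 a2 k1 k2 : ℤ)

/-- `i_k`: 1 if `k` is odd, 2 if `k` is even. -/
def idx (k : ℤ) : ℤ := if k % 2 = 1 then 1 else 2

/-- membership in the index set `I = {1,2}`. -/
def IsI (i : ℤ) : Prop := i = 1 ∨ i = 2

/-- `⟨α_{i_j}, α_{i_k}^∨⟩`. -/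
def pairJK (j k : ℤ) : ℤ :=
  if j % 2 = k % 2 then 2 else if k % 2 = 1 then -a1 else -a2

/-- `⟨α_{i_j}, α_i^∨⟩` for `i ∈ {1,2}`. -/
def pairJI (j i : ℤ) : ℤ :=
  if idx j = i then 2 else if i = 1 then -a1 else -a2

/-- `α_{i_j}` in the `(Λ1, Λ2)`-coordinates. -/
def alphaOf (j : ℤ) : ℤ × ℤ := if j % 2 = 1 then (2, -a2) else (-a1, 2)

/-- `⟨ν, α_i^∨⟩` for a weight `ν` in `(Λ1, Λ2)`-coordinates. -/
def pairW (ν : ℤ × ℤ) (i : ℤ) : ℤ := if i = 1 then ν.1 else ν.2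

/-- the sequence `c_j`. -/
def cseq : ℕ → ℤ
  | 0 => 0
  | 1 => 1
  | j + 2 => (if j % 2 = 0 then a1 else a2) * cseq (j + 1) - cseq j

/-- the sequence `c'_j`. -/
def cseq' : ℕ → ℤ
  | 0 => 0
  | 1 => 1
  | j + 2 => (if j % 2 = 0 then a2 else a1) * cseq' (j + 1) - cseq' j

noncomputable def alphaR : ℝ :=
  ((a1 : ℝ) * a2 + Real.sqrt ((a1 : ℝ) ^ 2 * (a2 : ℝ) ^ 2 - 4 * a1 * a2)) / (2 * a2)

noncomputable def betaR : ℝ :=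
  ((a1 : ℝ) * a2 + Real.sqrt ((a1 : ℝ) ^ 2 * (a2 : ℝ) ^ 2 - 4 * a1 * a2)) / (2 * a1)

/-- `γ_k = α` if `k` even, `β` if `k` odd. -/
noncomputable def gammaR (k : ℤ) : ℝ := if k % 2 = 0 then alphaR a1 a2 else betaR a1 a2

/-- `p_m` for `m ≥ 0`. -/
def ppos : ℕ → ℤ
  | 0 => k2
  | 1 => k1
  | m + 2 => (if m % 2 = 0 then a2 else a1) * ppos (m + 1) - ppos m

/-- `p_{-n}` for `n ≥ 0`. -/
def pneg : ℕ → ℤ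
  | 0 => k2
  | 1 => a1 * k2 - k1
  | n + 2 => (if (n + 2) % 2 = 0 then a2 else a1) * pneg (n + 1) - pneg n

/-- the two-sided sequence `p_m`, `m ∈ ℤ`, with `p_0 = k2`, `p_1 = k1`. -/
def pseq (m : ℤ) : ℤ :=
  if 0 ≤ m then ppos a1 a2 k1 k2 m.toNat else pneg a1 a2 k1 k2 (-m).toNat

/-- `λ = k1·Λ1 − k2·Λ2` in `(Λ1, Λ2)`-coordinates. -/
def lamW : ℤ × ℤ := (k1, -k2)

/-- membership in `ℤ^{+∞}` (coordinates supported on positions `≥ 1`, nonnegative,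
finitely supported). -/
def ZPlusMem (x : ℤ → ℤ) : Prop :=
  (∀ k : ℤ, k ≤ 0 → x k = 0) ∧ (∀ k : ℤ, 0 ≤ x k) ∧ ∃ N : ℕ, ∀ k : ℤ, (N : ℤ) < k → x k = 0

/-- membership in `ℤ^{−∞}` (coordinates supported on positions `≤ 0`, nonpositive,
finitely supported). -/
def ZMinusMem (x : ℤ → ℤ) : Prop :=
  (∀ k : ℤ, 1 ≤ k → x k = 0) ∧ (∀ k : ℤ, x k ≤ 0) ∧ ∃ N : ℕ, ∀ k : ℤ, k < -(N : ℤ) → x k = 0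

/-- membership in `X+ = Img(Ψ⁺)`. -/
def XPlusMem (x : ℤ → ℤ) : Prop :=
  ZPlusMem x ∧ ∀ j : ℤ, 1 ≤ j →
    0 ≤ cseq a1 a2 j.toNat * x j - cseq a1 a2 (j - 1).toNat * x (j + 1)

/-- membership in `X− = Img(Ψ⁻)`. -/
def XMinusMem (x : ℤ → ℤ) : Prop :=
  ZMinusMem x ∧ ∀ j : ℤ, j ≤ 0 →
    cseq' a1 a2 (1 - j).toNat * x j - cseq' a1 a2 (-j).toNat * x (j - 1) ≤ 0

def posPart (x : ℤ → ℤ) : ℤ → ℤ := fun k => if 1 ≤ k then x k else 0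
def negPart (x : ℤ → ℤ) : ℤ → ℤ := fun k => if k ≤ 0 then x k else 0

/-- membership in `Z_ι(μ) = ℤ^{+∞} ⊗ t_μ ⊗ ℤ^{−∞}` (in coordinates). -/
def ZMem (x : ℤ → ℤ) : Prop := ZPlusMem (posPart x) ∧ ZMinusMem (negPart x)

/-- membership in `X+ ⊗ t_λ ⊗ X−` (in coordinates). -/
def XXMem (x : ℤ → ℤ) : Prop := XPlusMem a1 a2 (posPart x) ∧ XMinusMem a1 a2 (negPart x)

/-- `σ_k` on `ℤ^{+∞}` (for `k ≥ 1`). -/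
noncomputable def sigmaP (x : ℤ → ℤ) (k : ℤ) : ℤ :=
  x k + ∑ᶠ j : ℤ, if k < j then pairJK a1 a2 j k * x j else 0

/-- `σ_k` on `ℤ^{−∞}` (for `k ≤ 0`). -/
noncomputable def sigmaM (x : ℤ → ℤ) (k : ℤ) : ℤ :=
  -(x k) - ∑ᶠ j : ℤ, if j < k then pairJK a1 a2 j k * x j else 0

/-- `−Σ_j x_j α_{i_j}` in `(Λ1, Λ2)`-coordinates. -/
noncomputable def wtOf (x : ℤ → ℤ) : ℤ × ℤ :=
  (-∑ᶠ j : ℤ, x j * (alphaOf a1 a2 j).1, -∑ᶠ j : ℤ, x j * (alphaOf a1 a2 j).2)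

/-- `wt(x) = μ − Σ_j x_j α_{i_j}`. -/
noncomputable def wtZ (μ : ℤ × ℤ) (x : ℤ → ℤ) : ℤ × ℤ := μ + wtOf a1 a2 x

/-- `σ_k` on `Z_ι(μ)`. -/
noncomputable def sigmaZ (μ : ℤ × ℤ) (x : ℤ → ℤ) (k : ℤ) : ℤ :=
  if 1 ≤ k then sigmaP a1 a2 x k
  else sigmaM a1 a2 x k - pairW (wtZ a1 a2 μ x) (idx k)

/-- `ε_i` on `Z_ι(μ)`. -/
noncomputable def epsZ (μ : ℤ × ℤ) (x : ℤ → ℤ) (i : ℤ) : ℤ :=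
  sSup {s : ℤ | ∃ k : ℤ, idx k = i ∧ sigmaZ a1 a2 μ x k = s}

/-- `φ_i` on `Z_ι(μ)`. -/
noncomputable def phiZ (μ : ℤ × ℤ) (x : ℤ → ℤ) (i : ℤ) : ℤ :=
  epsZ a1 a2 μ x i + pairW (wtZ a1 a2 μ x) i

noncomputable def kmaxZ (μ : ℤ × ℤ) (x : ℤ → ℤ) (i : ℤ) : ℤ :=
  sSup {k : ℤ | idx k = i ∧ sigmaZ a1 a2 μ x k = epsZ a1 a2 μ x i}

noncomputable def kminZ (μ : ℤ × ℤ) (x : ℤ → ℤ) (i : ℤ) : ℤ :=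
  sInf {k : ℤ | idx k = i ∧ sigmaZ a1 a2 μ x k = epsZ a1 a2 μ x i}

/-- `ẽ_i` on `Z_ι(μ)`; `none` represents `0`. -/
noncomputable def eZ (μ : ℤ × ℤ) (i : ℤ) (x : ℤ → ℤ) : Option (ℤ → ℤ) :=
  if 0 < epsZ a1 a2 μ x i then
    some (Function.update x (kmaxZ a1 a2 μ x i) (x (kmaxZ a1 a2 μ x i) - 1))
  else none

/-- `f̃_i` on `Z_ι(μ)`; `none` represents `0`. -/
noncomputable def fZ (μ : ℤ × ℤ) (i : ℤ) (x : ℤ → ℤ) : Option (ℤ → ℤ) :=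
  if 0 < phiZ a1 a2 μ x i then
    some (Function.update x (kminZ a1 a2 μ x i) (x (kminZ a1 a2 μ x i) + 1))
  else none

/-- `ε_i` on `ℤ^{+∞}`. -/
noncomputable def epsP (x : ℤ → ℤ) (i : ℤ) : ℤ :=
  sSup {s : ℤ | ∃ k : ℤ, 1 ≤ k ∧ idx k = i ∧ sigmaP a1 a2 x k = s}

noncomputable def kmaxP (x : ℤ → ℤ) (i : ℤ) : ℤ :=
  sSup {k : ℤ | 1 ≤ k ∧ idx k = i ∧ sigmaP a1 a2 x k = epsP a1 a2 x i}

noncomputable def kminP (x : ℤ → ℤ) (i : ℤ) : ℤ :=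
  sInf {k : ℤ | 1 ≤ k ∧ idx k = i ∧ sigmaP a1 a2 x k = epsP a1 a2 x i}

/-- `ẽ_i` on `ℤ^{+∞}` (partial). -/
noncomputable def eP (i : ℤ) (x : ℤ → ℤ) : Option (ℤ → ℤ) :=
  if 0 < epsP a1 a2 x i then
    some (Function.update x (kmaxP a1 a2 x i) (x (kmaxP a1 a2 x i) - 1))
  else none

/-- `f̃_i` on `ℤ^{+∞}` (total). -/
noncomputable def fP (i : ℤ) (x : ℤ → ℤ) : ℤ → ℤ :=
  Function.update x (kminP a1 a2 x i) (x (kminP a1 a2 x i) + 1)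

/-- `φ_i` on `ℤ^{−∞}`. -/
noncomputable def phiMf (x : ℤ → ℤ) (i : ℤ) : ℤ :=
  sSup {s : ℤ | ∃ k : ℤ, k ≤ 0 ∧ idx k = i ∧ sigmaM a1 a2 x k = s}

noncomputable def kmaxM (x : ℤ → ℤ) (i : ℤ) : ℤ :=
  sSup {k : ℤ | k ≤ 0 ∧ idx k = i ∧ sigmaM a1 a2 x k = phiMf a1 a2 x i}

noncomputable def kminM (x : ℤ → ℤ) (i : ℤ) : ℤ :=
  sInf {k : ℤ | k ≤ 0 ∧ idx k = i ∧ sigmaM a1 a2 x k = phiMf a1 a2 x i}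

/-- `ẽ_i` on `ℤ^{−∞}` (total). -/
noncomputable def eM (i : ℤ) (x : ℤ → ℤ) : ℤ → ℤ :=
  Function.update x (kmaxM a1 a2 x i) (x (kmaxM a1 a2 x i) - 1)

noncomputable def fPiter (i : ℤ) (n : ℕ) (x : ℤ → ℤ) : ℤ → ℤ := (fP a1 a2 i)^[n] x

noncomputable def eMiter (i : ℤ) (n : ℕ) (x : ℤ → ℤ) : ℤ → ℤ := (eM a1 a2 i)^[n] x

noncomputable def ePiterO (i : ℤ) (n : ℕ) (ox : Option (ℤ → ℤ)) : Option (ℤ → ℤ) :=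
  (fun o => o.bind (eP a1 a2 i))^[n] ox

noncomputable def eZiterO (μ : ℤ × ℤ) (i : ℤ) (n : ℕ) (ox : Option (ℤ → ℤ)) : Option (ℤ → ℤ) :=
  (fun o => o.bind (eZ a1 a2 μ i))^[n] ox

noncomputable def fZiterO (μ : ℤ × ℤ) (i : ℤ) (n : ℕ) (ox : Option (ℤ → ℤ)) : Option (ℤ → ℤ) :=
  (fun o => o.bind (fZ a1 a2 μ i))^[n] ox

noncomputable def suppBoundP (x : ℤ → ℤ) : ℕ := sInf {N : ℕ | ∀ k : ℤ, (N : ℤ) < k → x k = 0}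

noncomputable def suppBoundM (x : ℤ → ℤ) : ℕ := sInf {N : ℕ | ∀ k : ℤ, k < -(N : ℤ) → x k = 0}

/-- `starPChain x n z = f̃_{i_1}^{x_1} ⋯ f̃_{i_n}^{x_n} (z)` on `ℤ^{+∞}`. -/
noncomputable def starPChain (x : ℤ → ℤ) : ℕ → (ℤ → ℤ) → (ℤ → ℤ)
  | 0, z => z
  | n + 1, z => starPChain x n (fPiter a1 a2 (idx ((n : ℤ) + 1)) ((x ((n : ℤ) + 1)).toNat) z)

/-- the `∗`-operation on `X+`: `(x⁺)* = f̃_{i_1}^{x_1} ⋯ f̃_{i_N}^{x_N} (z_∞)`. -/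
noncomputable def starP (x : ℤ → ℤ) : ℤ → ℤ :=
  starPChain a1 a2 x (suppBoundP x) (fun _ => 0)

/-- `starMChain x n z = ẽ_{i_0}^{−x_0} ⋯ ẽ_{i_{-(n-1)}}^{−x_{-(n-1)}} (z)` on `ℤ^{−∞}`. -/
noncomputable def starMChain (x : ℤ → ℤ) : ℕ → (ℤ → ℤ) → (ℤ → ℤ)
  | 0, z => z
  | n + 1, z => starMChain x n (eMiter a1 a2 (idx (-(n : ℤ))) ((-(x (-(n : ℤ)))).toNat) z)

/-- the `∗`-operation on `X−`. -/
noncomputable def starM (x : ℤ → ℤ) : ℤ → ℤ :=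
  starMChain a1 a2 x (suppBoundM x + 1) (fun _ => 0)

/-- combine a `ℤ^{+∞}`- and a `ℤ^{−∞}`-component into an element of `Z_ι(μ)`. -/
def combine (y z : ℤ → ℤ) : ℤ → ℤ := fun k => if 1 ≤ k then y k else z k

/-- the coordinates of `x* = (x⁺)* ⊗ t_μ ⊗ (x⁻)*`. -/
noncomputable def xstarFun (x : ℤ → ℤ) : ℤ → ℤ :=
  combine (starP a1 a2 (posPart x)) (starM a1 a2 (negPart x))

/-- the weight `μ = −λ − wt(x⁺) − wt(x⁻)` of `x*`. -/
noncomputable def mustar (lam : ℤ × ℤ) (x : ℤ → ℤ) : ℤ × ℤ :=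
  -lam - wtOf a1 a2 (posPart x) - wtOf a1 a2 (negPart x)

/-- `fPnegChain g n z = f̃_{i_{-(n-1)}}^{g(-(n-1))} ⋯ f̃_{i_{-1}}^{g(-1)} f̃_{i_0}^{g 0} (z)`. -/
noncomputable def fPnegChain (g : ℤ → ℕ) : ℕ → (ℤ → ℤ) → (ℤ → ℤ)
  | 0, z => z
  | n + 1, z => fPiter a1 a2 (idx (-(n : ℤ))) (g (-(n : ℤ))) (fPnegChain g n z)

/-- `eMposChain g n z = ẽ_{i_n}^{g n} ⋯ ẽ_{i_2}^{g 2} ẽ_{i_1}^{g 1} (z)`. -/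
noncomputable def eMposChain (g : ℤ → ℕ) : ℕ → (ℤ → ℤ) → (ℤ → ℤ)
  | 0, z => z
  | n + 1, z => eMiter a1 a2 (idx ((n : ℤ) + 1)) (g ((n : ℤ) + 1)) (eMposChain g n z)

/-- `ePposChainO g n z = ẽ_{i_n}^{g n} ⋯ ẽ_{i_2}^{g 2} ẽ_{i_1}^{g 1} (z)` on `ℤ^{+∞}`. -/
noncomputable def ePposChainO (g : ℤ → ℕ) : ℕ → Option (ℤ → ℤ) → Option (ℤ → ℤ)
  | 0, z => z
  | n + 1, z => ePiterO a1 a2 (idx ((n : ℤ) + 1)) (g ((n : ℤ) + 1)) (ePposChainO g n z)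

/-- the Weyl group action `S_i` on `Z_ι(μ) ∪ {0}`. -/
noncomputable def SiO (μ : ℤ × ℤ) (i : ℤ) (ob : Option (ℤ → ℤ)) : Option (ℤ → ℤ) :=
  ob.bind fun b =>
    if 0 ≤ pairW (wtZ a1 a2 μ b) i then
      fZiterO a1 a2 μ i (pairW (wtZ a1 a2 μ b) i).toNat (some b)
    else eZiterO a1 a2 μ i (-(pairW (wtZ a1 a2 μ b) i)).toNat (some b)

/-- `SwPos μ n = S_{i_n} ⋯ S_{i_2} S_{i_1}`. -/
noncomputable def SwPos (μ : ℤ × ℤ) : ℕ → Option (ℤ → ℤ) → Option (ℤ → ℤ)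
  | 0, b => b
  | n + 1, b => SiO a1 a2 μ (idx ((n : ℤ) + 1)) (SwPos μ n b)

/-- `SwNeg μ n = S_{i_{-(n-1)}} ⋯ S_{i_{-1}} S_{i_0}`. -/
noncomputable def SwNeg (μ : ℤ × ℤ) : ℕ → Option (ℤ → ℤ) → Option (ℤ → ℤ)
  | 0, b => b
  | n + 1, b => SiO a1 a2 μ (idx (-(n : ℤ))) (SwNeg μ n b)

/-- `S_{w_k}`. -/
noncomputable def Swk (μ : ℤ × ℤ) (k : ℤ) (b : Option (ℤ → ℤ)) : Option (ℤ → ℤ) :=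
  if 0 ≤ k then SwPos a1 a2 μ k.toNat b else SwNeg a1 a2 μ (-k).toNat b

/-- `b ∈ Z_ι(μ)` is extremal. -/
noncomputable def Extremal (μ : ℤ × ℤ) (b : ℤ → ℤ) : Prop :=
  ∀ js : List ℤ, (∀ j ∈ js, IsI j) →
    ∃ b', js.foldr (SiO a1 a2 μ) (some b) = some b' ∧
      ∀ i : ℤ, IsI i →
        (0 ≤ pairW (wtZ a1 a2 μ b') i → eZ a1 a2 μ i b' = none) ∧
        (pairW (wtZ a1 a2 μ b') i ≤ 0 → fZ a1 a2 μ i b' = none)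

/-- `φ(x) ≥ 0` for all `φ ∈ Ξ_ι[λ]`. -/
noncomputable def SigmaCond (x : ℤ → ℤ) : Prop :=
  (0 ≤ gammaR a1 a2 0 * (pseq a1 a2 k1 k2 0 : ℝ) + gammaR a1 a2 0 * (x 0 : ℝ) - (x 1 : ℝ)) ∧
  (0 ≤ gammaR a1 a2 1 * (pseq a1 a2 k1 k2 1 : ℝ) + (x 0 : ℝ) - gammaR a1 a2 1 * (x 1 : ℝ)) ∧
  (∀ k : ℤ, 1 ≤ k → 0 ≤ (pseq a1 a2 k1 k2 k : ℝ) - (x k : ℝ)) ∧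
  (∀ k : ℤ, 1 ≤ k → 0 ≤ gammaR a1 a2 k * (x k : ℝ) - (x (k + 1) : ℝ)) ∧
  (∀ k : ℤ, 1 ≤ k → 0 ≤ gammaR a1 a2 (k + 1) * (pseq a1 a2 k1 k2 (k + 1) : ℝ) -
      (pseq a1 a2 k1 k2 k : ℝ) + (x k : ℝ) - gammaR a1 a2 (k + 1) * (x (k + 1) : ℝ)) ∧
  (∀ k : ℤ, k ≤ 0 → 0 ≤ (pseq a1 a2 k1 k2 k : ℝ) + (x k : ℝ)) ∧
  (∀ k : ℤ, k ≤ 0 → 0 ≤ (x (k - 1) : ℝ) - gammaR a1 a2 k * (x k : ℝ)) ∧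
  (∀ k : ℤ, k ≤ 0 → 0 ≤ gammaR a1 a2 (k - 1) * (pseq a1 a2 k1 k2 (k - 1) : ℝ) -
      (pseq a1 a2 k1 k2 k : ℝ) + gammaR a1 a2 (k - 1) * (x (k - 1) : ℝ) - (x k : ℝ))

/-- membership in `Σ_ι[λ]`. -/
noncomputable def SigmaMem (x : ℤ → ℤ) : Prop :=
  ZMem x ∧ SigmaCond a1 a2 k1 k2 x

/-- membership in `Σ'_ι[λ]`. -/
noncomputable def SigmaPrimeMem (x : ℤ → ℤ) : Prop :=
  SigmaMem a1 a2 k1 k2 x ∧ (∀ k : ℤ, k ≤ 0 → x k = 0) ∧ XPlusMem a1 a2 (posPart x)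

/-- evaluation of an affine function `φ = (c, (φ_l)_l)` at `x`. -/
noncomputable def evalAff (φ : ℝ × (ℤ → ℝ)) (x : ℤ → ℤ) : ℝ :=
  φ.1 + ∑ᶠ l : ℤ, φ.2 l * (x l : ℝ)

/-- `a_{i_k}`. -/
def aIdx (k : ℤ) : ℤ := if k % 2 = 1 then a1 else a2

/-- the affine function `b̄_k`. -/
noncomputable def bbar (lam : ℤ × ℤ) (k : ℤ) : ℝ × (ℤ → ℝ) :=
  ((if k = -1 ∨ k = 0 then -(pairW lam (idx k) : ℝ) else 0),
    fun l => (if l = k then (1 : ℝ) else 0) + (if l = k + 1 then -(aIdx a1 a2 k : ℝ) else 0) +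
      (if l = k + 2 then (1 : ℝ) else 0))

/-- the operator `S̄_k` on affine functions. -/
noncomputable def SbarOp (lam : ℤ × ℤ) (k : ℤ) (φ : ℝ × (ℤ → ℝ)) : ℝ × (ℤ → ℝ) :=
  let b := if 0 ≤ φ.2 k then bbar a1 a2 lam (k + 2) else bbar a1 a2 lam (k - 2)
  (φ.1 - φ.2 k * b.1, fun l => φ.2 l - φ.2 k * b.2 l)

end HypCrystal

open Finsupp

namespace HypCrystal

variable {a1 a2 : ℤ}

section Model

variable (a1 a2)

/-- The coefficient of `x_j` in `σ_k(x)`. -/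
def wgt (k j : ℤ) : ℤ := if j = k then 1 else if k < j then pairJK a1 a2 j k else 0

/-- `σ_k` as a function on finitely supported sequences. -/
noncomputable def sg (k : ℤ) (x : ℤ →₀ ℤ) : ℤ := x.sum fun j n => wgt a1 a2 k j * n

/-- `Σ_j x_j ⟨α_{i_j}, α_i^∨⟩`. -/
noncomputable def tot (i : ℤ) (x : ℤ →₀ ℤ) : ℤ := x.sum fun j n => pairJI a1 a2 j i * n

/-- In the crystal on sequences supported on positions `> s`, the operator `f̃_i` acts on `x`
at position `k`. -/
def ActsAt (s i : ℤ) (x : ℤ →₀ ℤ) (k : ℤ) : Prop :=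
  s < k ∧ idx k = i ∧ (∀ l, s < l → idx l = i → sg a1 a2 l x ≤ sg a1 a2 k x) ∧
    ∀ l, s < l → l < k → idx l = i → sg a1 a2 l x < sg a1 a2 k x

/-- In the crystal on sequences supported on positions `> s`, the operator `ẽ_i` acts on `x`
at position `k`. -/
def LowersAt (s i : ℤ) (x : ℤ →₀ ℤ) (k : ℤ) : Prop :=
  s < k ∧ idx k = i ∧ (∀ l, s < l → idx l = i → sg a1 a2 l x ≤ sg a1 a2 k x) ∧
    0 < sg a1 a2 k x ∧ ∀ l, k < l → idx l = i → sg a1 a2 l x < sg a1 a2 k x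

/-- `ε_i(x) = e` in the crystal on sequences supported on positions `> s`. -/
def IsEps (s i : ℤ) (x : ℤ →₀ ℤ) (e : ℤ) : Prop :=
  (∀ l, s < l → idx l = i → sg a1 a2 l x ≤ e) ∧ ∃ l, s < l ∧ idx l = i ∧ sg a1 a2 l x = e

/-- `StringData s t x m`: in the crystal on sequences supported on positions `> s`,
`m = f̃_{i_{t+1}}^{x_{t+1}} f̃_{i_{t+2}}^{x_{t+2}} ⋯ (0)`, and `x` is the string datum of `m`
along the colours `i_{t+1}, i_{t+2}, …`. -/
inductive StringData (s : ℤ) : ℤ → (ℤ →₀ ℤ) → (ℤ →₀ ℤ) → Prop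
  | zero (t : ℤ) : StringData s t 0 0
  | step {t : ℤ} {x m : ℤ →₀ ℤ} {k : ℤ} : StringData s t x m →
      ActsAt a1 a2 s (idx (t + 1)) m k →
      StringData s t (x + single (t + 1) 1) (m + single k 1)
  | shift {t : ℤ} {x m : ℤ →₀ ℤ} : StringData s (t + 1) x m →
      IsEps a1 a2 s (idx (t + 1)) m 0 → StringData s t x m

end Model


theorem idx_eq_idx {k l : ℤ} : idx k = idx l ↔ k % 2 = l % 2 := by
  unfold idx
  split <;> split <;> omega

theorem idx_isI (k : ℤ) : IsI (idx k) := by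
  unfold IsI idx
  split <;> simp

theorem pairJI_idx (j k : ℤ) : pairJI a1 a2 j (idx k) = pairJK a1 a2 j k := by
  unfold pairJI pairJK
  by_cases h : j % 2 = k % 2
  · rw [if_pos (idx_eq_idx.2 h), if_pos h]
  · rw [if_neg (mt idx_eq_idx.1 h), if_neg h]
    unfold idx
    split <;> simp

theorem sg_add_single (k l c : ℤ) (x : ℤ →₀ ℤ) :
    sg a1 a2 k (x + single l c) = sg a1 a2 k x + wgt a1 a2 k l * c := by
  unfold sg
  rw [Finsupp.sum_add_index' (by simp) (by intros; ring), Finsupp.sum_single_index (by simp)]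

theorem tot_add_single (i l c : ℤ) (x : ℤ →₀ ℤ) :
    tot a1 a2 i (x + single l c) = tot a1 a2 i x + pairJI a1 a2 l i * c := by
  unfold tot
  rw [Finsupp.sum_add_index' (by simp) (by intros; ring), Finsupp.sum_single_index (by simp)]

@[simp] theorem sg_zero (k : ℤ) : sg a1 a2 k 0 = 0 := by simp [sg]

theorem sg_add_self (k : ℤ) (x : ℤ →₀ ℤ) :
    sg a1 a2 k (x + single k 1) = sg a1 a2 k x + 1 := by
  simp [sg_add_single, wgt]

theorem sg_add_left {k l : ℤ} (h : l < k) (x : ℤ →₀ ℤ) :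
    sg a1 a2 k (x + single l 1) = sg a1 a2 k x := by
  simp [sg_add_single, wgt, h.ne, h.not_gt]

theorem sg_add_right {k l : ℤ} (h : k < l) (hi : idx l = idx k) (x : ℤ →₀ ℤ) :
    sg a1 a2 k (x + single l 1) = sg a1 a2 k x + 2 := by
  simp [sg_add_single, wgt, h.ne', h, pairJK, idx_eq_idx.1 hi]

theorem sg_eq_zero_of_large {x : ℤ →₀ ℤ} {k : ℤ} (h : ∀ j, k ≤ j → x j = 0) :
    sg a1 a2 k x = 0 := by
  refine Finset.sum_eq_zero fun j hj => ?_
  by_cases hk : k ≤ j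
  · simp [h j hk]
  · simp [wgt, show j ≠ k by omega, show ¬ k < j by omega]

theorem exists_support_bound (x : ℤ →₀ ℤ) : ∃ N : ℤ, ∀ j, N ≤ j → x j = 0 := by
  obtain ⟨N, hN⟩ := x.support.bddAbove
  refine ⟨N + 1, fun j hj => ?_⟩
  by_contra h
  have := hN (Finsupp.mem_support_iff.2 h)
  omega

/-- For sequences supported on positions `≥ k`, `σ_k(x) + x_k` only depends on the weight. -/
theorem sg_add_apply {x : ℤ →₀ ℤ} {k : ℤ} (h : ∀ j, j < k → x j = 0) :
    sg a1 a2 k x + x k = tot a1 a2 (idx k) x := by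
  have hk : x k = x.sum fun j n => if j = k then n else 0 := by
    simp [Finsupp.sum_ite_eq']
  rw [hk]
  unfold sg tot
  rw [← Finsupp.sum_add]
  refine Finset.sum_congr rfl fun j hj => ?_
  simp only [pairJI_idx]
  rcases lt_trichotomy j k with hjk | rfl | hjk
  · simp [h j hjk]
  · simp [wgt, pairJK]; ring
  · simp [wgt, hjk.ne', hjk]

theorem IsEps.unique {s i : ℤ} {x : ℤ →₀ ℤ} {e e' : ℤ} (h : IsEps a1 a2 s i x e)
    (h' : IsEps a1 a2 s i x e') : e = e' := by
  obtain ⟨h1, l, hl, hli, rfl⟩ := h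
  obtain ⟨h1', l', hl', hli', rfl⟩ := h'
  exact le_antisymm (h1' _ hl hli) (h1 _ hl' hli')

theorem ActsAt.isEps {s i : ℤ} {x : ℤ →₀ ℤ} {k : ℤ} (h : ActsAt a1 a2 s i x k) :
    IsEps a1 a2 s i x (sg a1 a2 k x) :=
  ⟨h.2.2.1, k, h.1, h.2.1, rfl⟩

theorem ActsAt.unique {s i : ℤ} {x : ℤ →₀ ℤ} {k k' : ℤ} (h : ActsAt a1 a2 s i x k)
    (h' : ActsAt a1 a2 s i x k') : k = k' := by
  rcases lt_trichotomy k k' with hk | hk | hk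
  · exact absurd (h'.2.2.2 k h.1 hk h.2.1) (h.2.2.1 k' h'.1 h'.2.1).not_gt
  · exact hk
  · exact absurd (h.2.2.2 k' h'.1 hk h'.2.1) (h'.2.2.1 k h.1 h.2.1).not_gt

theorem LowersAt.unique {s i : ℤ} {x : ℤ →₀ ℤ} {k k' : ℤ} (h : LowersAt a1 a2 s i x k)
    (h' : LowersAt a1 a2 s i x k') : k = k' := by
  rcases lt_trichotomy k k' with hk | hk | hk
  · exact absurd (h.2.2.2.2 k' hk h'.2.1) (h'.2.2.1 k h.1 h.2.1).not_gt
  · exact hk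
  · exact absurd (h'.2.2.2.2 k hk h.2.1) (h.2.2.1 k' h'.1 h'.2.1).not_gt

/-- Far out on the right every `σ_l` vanishes, so `ε_i(x) ≥ 0`. -/
theorem exists_sg_eq_zero (x : ℤ →₀ ℤ) (s k : ℤ) :
    ∃ l, s < l ∧ idx l = idx k ∧ sg a1 a2 l x = 0 := by
  obtain ⟨N, hN⟩ := exists_support_bound x
  refine ⟨k + 2 * (|N| + |s| + |k| + 1), ?_, ?_, ?_⟩
  · have := le_abs_self s; have := neg_abs_le k; have := abs_nonneg N
    have := abs_nonneg k; have := abs_nonneg s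
    omega
  · rw [idx_eq_idx]; omega
  · refine sg_eq_zero_of_large fun j hj => hN j ?_
    have := le_abs_self N; have := neg_abs_le k; have := abs_nonneg s
    have := abs_nonneg k; have := abs_nonneg N
    omega

theorem IsEps.nonneg {s i : ℤ} {x : ℤ →₀ ℤ} {e : ℤ} (h : IsEps a1 a2 s i x e) : 0 ≤ e := by
  obtain ⟨h1, k, -, rfl, -⟩ := h
  obtain ⟨l, hl, hli, h0⟩ := exists_sg_eq_zero (a1 := a1) (a2 := a2) x s k
  exact h0 ▸ h1 l hl hli

theorem ActsAt.lowersAt {s i : ℤ} {x : ℤ →₀ ℤ} {k : ℤ} (h : ActsAt a1 a2 s i x k) :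
    LowersAt a1 a2 s i (x + single k 1) k := by
  obtain ⟨hk, rfl, hmax, hmin⟩ := h
  have h0 : 0 ≤ sg a1 a2 k x := (show IsEps a1 a2 s (idx k) x _ from ⟨hmax, k, hk, rfl, rfl⟩).nonneg
  refine ⟨hk, rfl, fun l hl hli => ?_, ?_, fun l hl hli => ?_⟩
  · rw [sg_add_self]
    rcases lt_trichotomy l k with hlk | rfl | hlk
    · rw [sg_add_right hlk hli.symm]; have := hmin l hl hlk hli; omega
    · rw [sg_add_self]
    · rw [sg_add_left hlk]; have := hmax l hl hli; omega
  · rw [sg_add_self]; omega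
  · rw [sg_add_self, sg_add_left hl]; have := hmax l (hk.trans hl) hli; omega

theorem LowersAt.actsAt {s i : ℤ} {x y : ℤ →₀ ℤ} {k : ℤ}
    (h : LowersAt a1 a2 s i x k) (hx : x = y + single k 1) : ActsAt a1 a2 s i y k := by
  obtain ⟨hk, rfl, hmax, hpos, hlast⟩ := h
  subst hx
  rw [sg_add_self] at hmax hpos hlast
  refine ⟨hk, rfl, fun l hl hli => ?_, fun l hl hlk hli => ?_⟩
  · rcases lt_trichotomy l k with hlk | rfl | hlk
    · have := hmax l hl hli; rw [sg_add_right hlk hli.symm] at this; omega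
    · exact le_rfl
    · have := hlast l hlk hli; rw [sg_add_left hlk] at this; omega
  · have := hmax l hl hli; rw [sg_add_right hlk hli.symm] at this; omega

theorem LowersAt.isEps {s i : ℤ} {x : ℤ →₀ ℤ} {k : ℤ} (h : LowersAt a1 a2 s i x k) :
    IsEps a1 a2 s i x (sg a1 a2 k x) :=
  ⟨h.2.2.1, k, h.1, h.2.1, rfl⟩

theorem ActsAt.isEps_add {s i : ℤ} {x : ℤ →₀ ℤ} {k e : ℤ} (h : ActsAt a1 a2 s i x k)
    (he : IsEps a1 a2 s i x e) : IsEps a1 a2 s i (x + single k 1) (e + 1) := by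
  rw [he.unique h.isEps, ← sg_add_self]
  exact h.lowersAt.isEps

theorem exists_isEps (s k : ℤ) (x : ℤ →₀ ℤ) : ∃ e, IsEps a1 a2 s (idx k) x e := by
  obtain ⟨N, hN⟩ := exists_support_bound x
  obtain ⟨l0, hl0, hli0, h0⟩ := exists_sg_eq_zero (a1 := a1) (a2 := a2) x s k
  obtain ⟨B, hB⟩ := ((Finset.Icc s N).image fun l => sg a1 a2 l x).bddAbove
  obtain ⟨e, ⟨l, hl, hli, hle⟩, hmax⟩ := Int.exists_greatest_of_bdd
    (P := fun e => ∃ l, s < l ∧ idx l = idx k ∧ sg a1 a2 l x = e)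
    ⟨max B 0, by
      rintro _ ⟨l, hl, -, rfl⟩
      by_cases hlN : l ≤ N
      · exact le_max_of_le_left (hB (by
          simp only [Finset.coe_image, Set.mem_image, Finset.coe_Icc, Set.mem_Icc]
          exact ⟨l, ⟨hl.le, hlN⟩, rfl⟩))
      · exact le_max_of_le_right
          (sg_eq_zero_of_large fun j hj => hN j (by omega)).le⟩
    ⟨0, l0, hl0, hli0, h0⟩
  exact ⟨e, fun l' hl' hli' => hmax _ ⟨l', hl', hli', rfl⟩, l, hl, hli, hle⟩

theorem IsEps.exists_actsAt {s i : ℤ} {x : ℤ →₀ ℤ} {e : ℤ} (h : IsEps a1 a2 s i x e) :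
    ∃ k, ActsAt a1 a2 s i x k := by
  obtain ⟨hmax, hex⟩ := h
  obtain ⟨k, ⟨hk, hki, rfl⟩, hmin⟩ := Int.exists_least_of_bdd
    (P := fun l => s < l ∧ idx l = i ∧ sg a1 a2 l x = e) ⟨s, fun z hz => hz.1.le⟩ hex
  refine ⟨k, hk, hki, hmax, fun l hl hlk hli => lt_of_le_of_ne (hmax l hl hli) fun he => ?_⟩
  exact absurd (hmin l ⟨hl, hli, he⟩) hlk.not_ge

theorem IsEps.exists_lowersAt {s i : ℤ} {x : ℤ →₀ ℤ} {e : ℤ} (h : IsEps a1 a2 s i x e)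
    (he : 0 < e) : ∃ k, LowersAt a1 a2 s i x k := by
  obtain ⟨hmax, hex⟩ := h
  obtain ⟨N, hN⟩ := exists_support_bound x
  obtain ⟨k, ⟨hk, hki, rfl⟩, hlast⟩ := Int.exists_greatest_of_bdd
    (P := fun l => s < l ∧ idx l = i ∧ sg a1 a2 l x = e) ⟨N, fun z hz => by
      by_contra hzN
      have := sg_eq_zero_of_large (a1 := a1) (a2 := a2) (x := x) (k := z)
        fun j hj => hN j (by omega)
      omega⟩ hex
  refine ⟨k, hk, hki, hmax, he, fun l hl hli =>
    lt_of_le_of_ne (hmax l (hk.trans hl) hli) fun h => ?_⟩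
  exact absurd (hlast l ⟨hk.trans hl, hli, h⟩) hl.not_ge

theorem IsEps.add_first {t i : ℤ} {x : ℤ →₀ ℤ} {e : ℤ} (h : IsEps a1 a2 t i x e)
    (hlt : idx (t + 1) = i → sg a1 a2 (t + 1) x < e) :
    IsEps a1 a2 t i (x + single (t + 1) 1) e := by
  obtain ⟨hmax, l, hl, hli, hle⟩ := h
  have key : ∀ l, t < l → l ≠ t + 1 → sg a1 a2 l (x + single (t + 1) 1) = sg a1 a2 l x :=
    fun l hl hne => sg_add_left (by omega) x
  refine ⟨fun l hl hli => ?_, l, hl, hli, ?_⟩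
  · by_cases hlt1 : l = t + 1
    · subst hlt1
      rw [sg_add_self]
      exact hlt hli
    · rw [key l hl hlt1]
      exact hmax l hl hli
  · rw [key l hl, hle]
    rintro rfl
    exact absurd hle (hlt hli).ne

theorem ActsAt.add_first {t i k : ℤ} {x : ℤ →₀ ℤ} (h : ActsAt a1 a2 t i x k) (hk : k ≠ t + 1)
    (hlt : idx (t + 1) = i → sg a1 a2 (t + 1) x + 1 < sg a1 a2 k x) :
    ActsAt a1 a2 t i (x + single (t + 1) 1) k := by
  obtain ⟨hk0, hki, hmax, hmin⟩ := h
  have key : ∀ l, t < l → l ≠ t + 1 → sg a1 a2 l (x + single (t + 1) 1) = sg a1 a2 l x :=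
    fun l hl hne => sg_add_left (by omega) x
  refine ⟨hk0, hki, fun l hl hli => ?_, fun l hl hlk hli => ?_⟩
  all_goals
    rw [key k hk0 hk]
    by_cases hlt1 : l = t + 1
    · subst hlt1
      rw [sg_add_self]
      have := hlt hli
      omega
    · rw [key l hl hlt1]
      first | exact hmin l hl hlk hli | exact hmax l hl hli

theorem actsAt_first {t i : ℤ} {x : ℤ →₀ ℤ} {e : ℤ} (h : IsEps a1 a2 t i x e)
    (hi : idx (t + 1) = i) (he : sg a1 a2 (t + 1) x = e) : ActsAt a1 a2 t i x (t + 1) := by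
  subst he
  exact ⟨by omega, hi, h.1, fun l hl hlt _ => by omega⟩

theorem ActsAt.of_succ {t i k : ℤ} {x : ℤ →₀ ℤ} (h : ActsAt a1 a2 (t + 1) i x k)
    (hlt : idx (t + 1) = i → sg a1 a2 (t + 1) x < sg a1 a2 k x) : ActsAt a1 a2 t i x k := by
  obtain ⟨hk0, hki, hmax, hmin⟩ := h
  refine ⟨by omega, hki, fun l hl hli => ?_, fun l hl hlk hli => ?_⟩
  all_goals
    by_cases hlt1 : l = t + 1
    · subst hlt1
      first | exact hlt hli | exact (hlt hli).le
    · first | exact hmin l (by omega) hlk hli | exact hmax l (by omega) hli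

theorem ActsAt.to_succ {t i k : ℤ} {x : ℤ →₀ ℤ} (h : ActsAt a1 a2 t i x k) (hk : k ≠ t + 1) :
    ActsAt a1 a2 (t + 1) i x k :=
  ⟨by have := h.1; omega, h.2.1, fun l hl hli => h.2.2.1 l (by omega) hli,
    fun l hl hlk hli => h.2.2.2 l (by omega) hlk hli⟩

theorem IsEps.of_succ {t i e : ℤ} {x : ℤ →₀ ℤ} (h : IsEps a1 a2 (t + 1) i x e)
    (hle : idx (t + 1) = i → sg a1 a2 (t + 1) x ≤ e) : IsEps a1 a2 t i x e := by
  obtain ⟨hmax, l, hl, hli, he⟩ := h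
  refine ⟨fun l hl hli => ?_, l, by omega, hli, he⟩
  by_cases hlt1 : l = t + 1
  · subst hlt1
    exact hle hli
  · exact hmax l (by omega) hli

theorem IsEps.zero_of_le {s i e : ℤ} {y : ℤ →₀ ℤ} (hy : IsEps a1 a2 s i y e)
    (hle : ∀ l, s < l → idx l = i → sg a1 a2 l y ≤ 0) :
    IsEps a1 a2 s i y 0 := by
  have h1 := hy.nonneg
  obtain ⟨l, hl, hli, he⟩ := hy.2
  have h2 := hle l hl hli
  rwa [show (0 : ℤ) = e by omega]

theorem isEps_zero (s k : ℤ) : IsEps a1 a2 s (idx k) 0 0 := by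
  obtain ⟨e, he⟩ := exists_isEps (a1 := a1) (a2 := a2) s k 0
  obtain ⟨l, -, -, h⟩ := he.2
  rw [sg_zero] at h
  rwa [h]

theorem pairJI_congr {j k : ℤ} (h : idx j = idx k) (i : ℤ) :
    pairJI a1 a2 j i = pairJI a1 a2 k i := by
  unfold pairJI
  rw [h]

theorem add_single_nonneg {x : ℤ →₀ ℤ} (h : ∀ k, 0 ≤ x k) (l k : ℤ) :
    0 ≤ (x + single l 1 : ℤ →₀ ℤ) k := by
  rw [Finsupp.add_apply, Finsupp.single_apply]
  have := h k
  split <;> omega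

namespace StringData

variable {s t : ℤ} {x m : ℤ →₀ ℤ}

theorem eq_zero_of_le (h : StringData a1 a2 s t x m) : ∀ k ≤ t, x k = 0 := by
  induction h with
  | zero => simp
  | @step t x m l h ha ih =>
    intro k hk
    simp [ih k hk, show t + 1 ≠ k by omega]
  | shift h he ih => intro k hk; exact ih k (by omega)

theorem eq_zero_of_le' (h : StringData a1 a2 s t x m) : ∀ k ≤ s, m k = 0 := by
  induction h with
  | zero => simp
  | @step t x m l h ha ih =>
    intro k hk
    have := ha.1
    simp [ih k hk, show l ≠ k by omega]
  | shift h he ih => exact ih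

theorem nonneg (h : StringData a1 a2 s t x m) : ∀ k, 0 ≤ x k := by
  induction h with
  | zero => simp
  | step h ha ih => exact add_single_nonneg ih _
  | shift h he ih => exact ih

theorem tot_eq (h : StringData a1 a2 s t x m) (i : ℤ) : tot a1 a2 i x = tot a1 a2 i m := by
  induction h with
  | zero => rfl
  | step h ha ih => rw [tot_add_single, tot_add_single, ih, pairJI_congr ha.2.1]
  | shift h he ih => exact ih

theorem isEps (h : StringData a1 a2 s t x m) : IsEps a1 a2 s (idx (t + 1)) m (x (t + 1)) := by
  induction h with
  | zero => exact isEps_zero _ _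
  | step h ha ih => simpa using ha.isEps_add ih
  | shift h he ih => rwa [h.eq_zero_of_le _ le_rfl]

/-- The first coordinates and the values of `σ` at the first positions of a sequence and of its
string datum are related through the common weight. -/
theorem sg_first (h : StringData a1 a2 s t x m) (hst : idx (t + 1) = idx (s + 1)) :
    sg a1 a2 (t + 1) x + x (t + 1) = sg a1 a2 (s + 1) m + m (s + 1) := by
  rw [sg_add_apply fun j hj => h.eq_zero_of_le j (by omega),
    sg_add_apply fun j hj => h.eq_zero_of_le' j (by omega), hst, h.tot_eq]

theorem isEps' (h : StringData a1 a2 s t x m) : IsEps a1 a2 t (idx (s + 1)) x (m (s + 1)) := by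
  induction h with
  | zero => exact isEps_zero _ _
  | @step t x m k h ha ih =>
    by_cases hst : idx (t + 1) = idx (s + 1)
    · have hf := h.sg_first hst
      have he := h.isEps
      by_cases hκ : sg a1 a2 (t + 1) x = m (s + 1)
      · have hk : k = s + 1 := ha.unique (actsAt_first he hst.symm (by omega))
        subst hk
        simpa using (actsAt_first ih hst hκ).isEps_add ih
      · have hk : k ≠ s + 1 := by
          rintro rfl
          have := he.unique ha.isEps
          omega
        have hle := ih.1 (t + 1) (by omega) hst
        simpa [single_apply, hk] using ih.add_first fun _ => by omega
    · have hk : k ≠ s + 1 := by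
        rintro rfl
        exact hst ha.2.1.symm
      simpa [single_apply, hk] using ih.add_first fun hi => absurd hi hst
  | @shift t x m h he ih =>
    refine ih.of_succ fun hst => ?_
    have h' := StringData.shift h he
    have hf := h'.sg_first hst
    have h0 := h.eq_zero_of_le _ le_rfl
    have := he.1 (s + 1) (by omega) hst.symm
    omega

theorem add_star (h : StringData a1 a2 s t x m) : ∀ {k}, ActsAt a1 a2 t (idx (s + 1)) x k →
    StringData a1 a2 s t (x + single k 1) (m + single (s + 1) 1) := by
  induction h with
  | zero t =>
    intro k hk
    have ha : ActsAt a1 a2 s (idx (s + 1)) 0 (s + 1) :=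
      actsAt_first (isEps_zero _ _) rfl (sg_zero _)
    by_cases hst : idx (t + 1) = idx (s + 1)
    · rw [hk.unique (actsAt_first (isEps_zero _ _) hst (sg_zero _))]
      exact (StringData.zero t).step (hst ▸ ha)
    · have hst2 : idx (t + 1 + 1) = idx (s + 1) := by
        rw [idx_eq_idx] at hst ⊢; omega
      have hk1 : k ≠ t + 1 := by
        rintro rfl
        exact hst hk.2.1
      rw [(hk.to_succ hk1).unique (actsAt_first (isEps_zero _ _) hst2 (sg_zero _))]
      refine ((StringData.zero (t + 1)).step (hst2 ▸ ha)).shift ?_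
      exact (isEps_zero _ _).add_first fun hi => absurd hi.symm hst
  | @step t x m l h ha ih =>
    intro k hk
    have h' := h.step ha
    have hex := h.isEps'
    have hem := h.isEps
    obtain ⟨k0, hk0⟩ := hex.exists_actsAt
    by_cases hst : idx (t + 1) = idx (s + 1)
    · have hf := h.sg_first hst
      have hf' := h'.sg_first hst
      have hex' := h'.isEps'
      have hem' := h'.isEps
      have hlex := hex.1 (t + 1) (by omega) hst
      by_cases hκ : m (s + 1) ≤ sg a1 a2 (t + 1) x + 1
      · have h1 : sg a1 a2 (t + 1) (x + single (t + 1) 1) = (m + single l 1 : ℤ →₀ ℤ) (s + 1) := by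
          rw [sg_add_self]
          by_cases hκ0 : sg a1 a2 (t + 1) x = m (s + 1)
          · rw [ha.unique (actsAt_first hem hst.symm (by omega))]
            simp [hκ0]
          · have hl : l ≠ s + 1 := by
              rintro rfl
              have := hem.unique ha.isEps
              omega
            simp [hl]
            omega
        rw [hk.unique (actsAt_first hex' hst h1)]
        refine h'.step ?_
        exact actsAt_first hem' hst.symm (by omega)
      · have hk0' : k0 ≠ t + 1 := by
          rintro rfl
          have := hex.unique hk0.isEps
          omega
        have hl : l ≠ s + 1 := by
          rintro rfl
          have := hem.unique ha.isEps
          omega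
        have e1 := hex.unique hk0.isEps
        have e2 := hem.unique ha.isEps
        rw [hk.unique (hk0.add_first hk0' fun _ => by omega)]
        rw [add_right_comm x, add_right_comm m]
        exact (ih hk0).step (ha.add_first hl fun _ => by omega)
    · have hk0' : k0 ≠ t + 1 := by
        rintro rfl
        exact hst hk0.2.1
      have hl : l ≠ s + 1 := by
        rintro rfl
        exact hst ha.2.1.symm
      rw [hk.unique (hk0.add_first hk0' fun hi => absurd hi hst)]
      rw [add_right_comm x, add_right_comm m]
      exact (ih hk0).step (ha.add_first hl fun hi => absurd hi.symm hst)
  | @shift t x m h he ih =>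
    intro k hk
    have h' := h.shift he
    have hex := h'.isEps'
    have h0 := h.eq_zero_of_le _ le_rfl
    by_cases hst : idx (t + 1) = idx (s + 1)
    · have hf := h'.sg_first hst
      by_cases hκ : sg a1 a2 (t + 1) x = m (s + 1)
      · rw [hk.unique (actsAt_first hex hst hκ)]
        exact h'.step (actsAt_first he hst.symm (by omega))
      · have hk1 : k ≠ t + 1 := by
          rintro rfl
          exact hκ (hk.isEps.unique hex)
        have := hex.1 (t + 1) (by omega) hst
        exact (ih (hk.to_succ hk1)).shift (he.add_first fun _ => by omega)
    · have hk1 : k ≠ t + 1 := by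
        rintro rfl
        exact hst hk.2.1
      exact (ih (hk.to_succ hk1)).shift (he.add_first fun hi => absurd hi.symm hst)

theorem shift_star (h : StringData a1 a2 (s + 1) t x m) :
    IsEps a1 a2 t (idx (s + 1)) x 0 → StringData a1 a2 s t x m := by
  induction h with
  | zero t => exact fun _ => .zero t
  | @step t x m k h ha ih =>
    intro he
    obtain ⟨e, hex⟩ := exists_isEps (a1 := a1) (a2 := a2) t (s + 1) x
    have hx0 : IsEps a1 a2 t (idx (s + 1)) x 0 := hex.zero_of_le fun l hl hli => by
      have h1 := he.1 l hl hli
      by_cases hlt : l = t + 1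
      · subst hlt
        rw [sg_add_self] at h1
        omega
      · rwa [sg_add_left (by omega)] at h1
    have h2 := ih hx0
    refine h2.step (ha.of_succ fun hst => ?_)
    have hf := h2.sg_first hst.symm
    have h3 := h2.isEps
    have h4 := h.eq_zero_of_le' _ le_rfl
    have h5 := he.1 (t + 1) (by omega) hst.symm
    rw [sg_add_self] at h5
    have h6 := h.isEps.unique ha.isEps
    omega
  | @shift t x m h he ih =>
    intro hx
    have h2 : StringData a1 a2 s (t + 1) x m := by
      obtain ⟨e, hex⟩ := exists_isEps (a1 := a1) (a2 := a2) (t + 1) (s + 1) x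
      exact ih (hex.zero_of_le fun l hl hli => hx.1 l (by omega) hli)
    refine h2.shift (he.of_succ fun hst => ?_)
    have h0 := h.eq_zero_of_le _ le_rfl
    have h4 := h.eq_zero_of_le' _ le_rfl
    have h5 := hx.1 (t + 1) (by omega) hst.symm
    have e1 := sg_add_apply (a1 := a1) (a2 := a2) (x := x) (k := t + 1)
      fun j hj => h2.eq_zero_of_le j (by omega)
    have e2 := sg_add_apply (a1 := a1) (a2 := a2) (x := m) (k := s + 1)
      fun j hj => h2.eq_zero_of_le' j (by omega)
    rw [hst, ← h2.tot_eq] at e2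
    omega

/-- The involution `∗`: passing to string data is symmetric. -/
theorem symm (h : StringData a1 a2 s t x m) : StringData a1 a2 t s m x := by
  induction h with
  | zero t => exact .zero s
  | step h ha ih => exact ih.add_star ha
  | shift h he ih => exact ih.shift_star he

theorem eq_zero_right (h : StringData a1 a2 s t x m) : x = 0 → m = 0 := by
  induction h with
  | zero => exact id
  | @step t x m k h ha ih =>
    intro h0
    have := DFunLike.congr_fun h0 (t + 1)
    have := h.nonneg (t + 1)
    simp at *
    omega
  | shift h he ih => exact ih

theorem pop (h : StringData a1 a2 s t x m) {m0 : ℤ →₀ ℤ} {k : ℤ} (hm : m = m0 + single k 1)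
    (hk : ActsAt a1 a2 s (idx (t + 1)) m0 k) :
    StringData a1 a2 s t (x - single (t + 1) 1) m0 := by
  have hlow : LowersAt a1 a2 s (idx (t + 1)) m k := hm ▸ hk.lowersAt
  cases h with
  | zero => have := hlow.2.2.2.1; simp at this
  | @step _ x m' k' h ha =>
    have hkk : k' = k := ha.lowersAt.unique hlow
    subst hkk
    rw [add_sub_cancel_right, ← add_right_cancel hm]
    exact h
  | shift h he =>
    have := hlow.isEps.unique he
    have := hlow.2.2.2.1
    omega

theorem unshift (h : StringData a1 a2 s t x m) (h0 : x (t + 1) = 0) :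
    StringData a1 a2 s (t + 1) x m := by
  cases h with
  | zero => exact .zero _
  | step h ha => have := h.nonneg (t + 1); simp at h0; omega
  | shift h he => exact h

end StringData

section Defs

variable (a1 a2)

/-- The standing assumption that the generalized Cartan matrix is of hyperbolic type. -/
def Hyperbolic : Prop := 1 ≤ a1 ∧ 1 ≤ a2 ∧ 4 < a1 * a2

/-- `-⟨α_{i_k}, α_{i_{k-1}}^∨⟩`. -/
def cart (k : ℤ) : ℤ := if k % 2 = 0 then a1 else a2

/-- The analogue of the sequence `c_j` for the crystal on positions `> s`. -/
def cgen (s : ℤ) : ℕ → ℤ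
  | 0 => 0
  | 1 => 1
  | n + 2 => cart a1 a2 (s + n + 2) * cgen s (n + 1) - cgen s n

/-- The image of `B(∞)` in the sequences supported on positions `> s`. -/
def Cone (s : ℤ) (x : ℤ →₀ ℤ) : Prop :=
  (∀ k ≤ s, x k = 0) ∧ (∀ k, 0 ≤ x k) ∧
    ∀ n : ℕ, cgen a1 a2 s n * x (s + n + 2) ≤ cgen a1 a2 s (n + 1) * x (s + n + 1)

end Defs


theorem cart_add_two (k : ℤ) : cart a1 a2 (k + 2) = cart a1 a2 k := by
  unfold cart
  rw [show (k + 2) % 2 = k % 2 by omega]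

theorem gammaR_add_two (k : ℤ) : gammaR a1 a2 (k + 2) = gammaR a1 a2 k := by
  unfold gammaR
  rw [show (k + 2) % 2 = k % 2 by omega]

theorem pairJK_of_ne {j k : ℤ} (h : j % 2 ≠ k % 2) : pairJK a1 a2 j k = -cart a1 a2 j := by
  unfold pairJK cart
  rw [if_neg h]
  split <;> split <;> first | rfl | omega

theorem sg_add (k : ℤ) (x y : ℤ →₀ ℤ) : sg a1 a2 k (x + y) = sg a1 a2 k x + sg a1 a2 k y := by
  unfold sg
  exact Finsupp.sum_add_index' (by simp) (by intros; ring)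

theorem sg_single (k l c : ℤ) : sg a1 a2 k (single l c) = wgt a1 a2 k l * c := by
  unfold sg
  rw [Finsupp.sum_single_index (by simp)]

theorem sg_sub_sg_add_two (k : ℤ) (x : ℤ →₀ ℤ) :
    sg a1 a2 k x - sg a1 a2 (k + 2) x = x k - cart a1 a2 (k + 1) * x (k + 1) + x (k + 2) := by
  induction x using Finsupp.induction_linear with
  | zero => simp
  | add x y hx hy =>
    rw [sg_add, sg_add, Finsupp.add_apply, Finsupp.add_apply, Finsupp.add_apply]
    linear_combination hx + hy
  | single l c =>
    rw [sg_single, sg_single]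
    simp only [single_apply, wgt]
    rcases lt_trichotomy l k with h | rfl | h
    · simp [show l ≠ k by omega, show l ≠ k + 1 by omega, show l ≠ k + 2 by omega,
        show ¬ k < l by omega, show ¬ k + 2 < l by omega]
    · simp
    by_cases h1 : l = k + 1
    · subst h1
      simp [pairJK_of_ne (show (k + 1) % 2 ≠ k % 2 by omega)]
    by_cases h2 : l = k + 2
    · subst h2
      simp [pairJK]
      ring
    have h3 : k + 2 < l := by omega
    have h4 : pairJK a1 a2 l (k + 2) = pairJK a1 a2 l k := by
      unfold pairJK
      rw [show (k + 2) % 2 = k % 2 by omega]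
    simp [show l ≠ k by omega, h1, h2, h, h3, h4]

theorem idx_add_two (k : ℤ) : idx (k + 2) = idx k := by rw [idx_eq_idx]; omega

namespace Hyperbolic

theorem gammaR_pos (ha : Hyperbolic a1 a2) (k : ℤ) : 0 < gammaR a1 a2 k := by
  have h1 : (1 : ℝ) ≤ a1 := by exact_mod_cast ha.1
  have h2 : (1 : ℝ) ≤ a2 := by exact_mod_cast ha.2.1
  have h := Real.sqrt_nonneg ((a1 : ℝ) ^ 2 * (a2 : ℝ) ^ 2 - 4 * a1 * a2)
  unfold gammaR alphaR betaR
  split <;> positivity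

theorem sqrt_sq (ha : Hyperbolic a1 a2) :
    Real.sqrt ((a1 : ℝ) ^ 2 * (a2 : ℝ) ^ 2 - 4 * a1 * a2) ^ 2 =
      (a1 : ℝ) ^ 2 * (a2 : ℝ) ^ 2 - 4 * a1 * a2 := by
  have h3 : (4 : ℝ) < a1 * a2 := by exact_mod_cast ha.2.2
  exact Real.sq_sqrt (by nlinarith)

theorem gammaR_mul_sub (ha : Hyperbolic a1 a2) (k : ℤ) :
    gammaR a1 a2 k * (cart a1 a2 (k + 1) - gammaR a1 a2 (k + 1)) = 1 := by
  have h1 : (0 : ℝ) < a1 := by exact_mod_cast ha.1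
  have h2 : (0 : ℝ) < a2 := by exact_mod_cast ha.2.1
  have hs := ha.sqrt_sq
  unfold gammaR alphaR betaR cart
  set r := Real.sqrt ((a1 : ℝ) ^ 2 * (a2 : ℝ) ^ 2 - 4 * a1 * a2)
  by_cases hk : k % 2 = 0
  · rw [if_pos hk, if_neg (by omega), if_neg (by omega)]
    field_simp
    linear_combination -hs
  · rw [if_neg hk, if_pos (by omega), if_pos (by omega)]
    field_simp
    linear_combination -hs

theorem one_lt_gammaR_mul (ha : Hyperbolic a1 a2) (k : ℤ) :
    1 < gammaR a1 a2 k * gammaR a1 a2 (k + 1) := by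
  have h1 : (0 : ℝ) < a1 := by exact_mod_cast ha.1
  have h2 : (0 : ℝ) < a2 := by exact_mod_cast ha.2.1
  have h3 : (4 : ℝ) < a1 * a2 := by exact_mod_cast ha.2.2
  have h := Real.sqrt_nonneg ((a1 : ℝ) ^ 2 * (a2 : ℝ) ^ 2 - 4 * a1 * a2)
  have hs := ha.sqrt_sq
  have key : 1 < alphaR a1 a2 * betaR a1 a2 := by
    unfold alphaR betaR
    rw [div_mul_div_comm, lt_div_iff₀ (by positivity)]
    nlinarith
  unfold gammaR
  by_cases hk : k % 2 = 0
  · rwa [if_pos hk, if_neg (by omega)]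
  · rwa [if_neg hk, if_pos (by omega), mul_comm]

/-- `A_{k+1} t - γ_{k+1} t = t / γ_k`, in the form used for estimates. -/
theorem mul_le_of_le (ha : Hyperbolic a1 a2) {k : ℤ} {u v : ℝ} (h : gammaR a1 a2 k * u ≤ v) :
    u ≤ (cart a1 a2 (k + 1) - gammaR a1 a2 (k + 1)) * v := by
  have h1 := ha.gammaR_mul_sub k
  have h0 := ha.gammaR_pos k
  have h2 : 0 < (cart a1 a2 (k + 1) : ℝ) - gammaR a1 a2 (k + 1) := by
    by_contra hn
    nlinarith
  calc u = (cart a1 a2 (k + 1) - gammaR a1 a2 (k + 1)) * (gammaR a1 a2 k * u) := by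
        linear_combination -u * h1
    _ ≤ _ := by gcongr

theorem cgen_growth (ha : Hyperbolic a1 a2) (s : ℤ) (n : ℕ) :
    0 < cgen a1 a2 s (n + 1) ∧
      gammaR a1 a2 (s + n + 1) * cgen a1 a2 s n ≤ cgen a1 a2 s (n + 1) := by
  induction n with
  | zero => simp [cgen]
  | succ n ih =>
    obtain ⟨ih1, ih2⟩ := ih
    have h := ha.mul_le_of_le ih2
    have e : s + (n : ℤ) + 1 + 1 = s + n + 2 := by ring
    rw [e] at h
    have h2 : gammaR a1 a2 (s + n + 2) * cgen a1 a2 s (n + 1) ≤ (cgen a1 a2 s (n + 2) : ℝ) := by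
      rw [show cgen a1 a2 s (n + 2) =
        cart a1 a2 (s + n + 2) * cgen a1 a2 s (n + 1) - cgen a1 a2 s n from rfl]
      push_cast
      linarith
    have h1' : (0 : ℝ) < cgen a1 a2 s (n + 1) := by exact_mod_cast ih1
    have h3 := mul_pos (ha.gammaR_pos (s + n + 2)) h1'
    refine ⟨by exact_mod_cast h3.trans_le h2, ?_⟩
    push_cast
    rw [show s + ((n : ℤ) + 1) + 1 = s + n + 2 by ring]
    exact h2

theorem cgen_nonneg (ha : Hyperbolic a1 a2) (s : ℤ) (n : ℕ) : 0 ≤ cgen a1 a2 s n := by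
  cases n with
  | zero => simp [cgen]
  | succ n => exact (ha.cgen_growth s n).1.le

end Hyperbolic

theorem cgen_succ_succ (s : ℤ) (n : ℕ) : cgen a1 a2 s (n + 2) =
    cart a1 a2 (s + n + 2) * cgen a1 a2 s (n + 1) - cgen a1 a2 s n := rfl

theorem Cone.add_single (ha : Hyperbolic a1 a2) {s i k : ℤ} {x : ℤ →₀ ℤ} (h : Cone a1 a2 s x)
    (hk : ActsAt a1 a2 s i x k) : Cone a1 a2 s (x + single k 1) := by
  obtain ⟨h1, h2, h3⟩ := h
  obtain ⟨hks, rfl, hmax, hmin⟩ := hk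
  refine ⟨fun l hl => ?_, add_single_nonneg h2 k, fun n => ?_⟩
  · simp [h1 l hl, show k ≠ l by omega]
  · have h3n := h3 n
    simp only [Finsupp.add_apply, single_apply]
    by_cases hk1 : k = s + n + 2
    · rw [if_pos hk1, if_neg (by omega), add_zero]
      cases n with
      | zero => simpa [cgen] using h2 _
      | succ n =>
        have h4 := hmin (k - 2) (by push_cast at hk1; omega) (by omega)
          (by rw [idx_eq_idx]; omega)
        have h5 := sg_sub_sg_add_two (a1 := a1) (a2 := a2) (k - 2) x
        have h6 := h3 n
        push_cast at *
        rw [show s + ((n : ℤ) + 1) + 2 = k by omega, show s + ((n : ℤ) + 1) + 1 = k - 2 + 1 by omega,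
          cgen_succ_succ, show s + (n : ℤ) + 2 = k - 2 + 1 by omega]
        rw [show s + (n : ℤ) + 2 = k - 2 + 1 by omega, show s + (n : ℤ) + 1 = k - 2 by omega] at h6
        rw [show k - 2 + 2 = k by ring] at h5
        have h7 := ha.cgen_nonneg s (n + 1)
        have h8 : x k + 1 ≤ cart a1 a2 (k - 2 + 1) * x (k - 2 + 1) - x (k - 2) := by omega
        nlinarith [mul_le_mul_of_nonneg_left h8 h7]
    · rw [if_neg hk1]
      have h7 := ha.cgen_nonneg s (n + 1)
      split
      · linarith
      · simpa using h3n

theorem Cone.of_lowersAt (ha : Hyperbolic a1 a2) {s i k : ℤ} {x : ℤ →₀ ℤ} (h : Cone a1 a2 s x)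
    (hk : LowersAt a1 a2 s i x k) : Cone a1 a2 s (x - single k 1) := by
  obtain ⟨h1, h2, h3⟩ := h
  obtain ⟨hks, rfl, -, -, hlast⟩ := hk
  obtain ⟨n, hn⟩ : ∃ n : ℕ, k = s + n + 1 := ⟨(k - s - 1).toNat, by omega⟩
  have h4 := hlast (k + 2) (by omega) (idx_add_two k)
  have h5 := sg_sub_sg_add_two (a1 := a1) (a2 := a2) k x
  have h6 := h3 (n + 1)
  have h7 := (ha.cgen_growth s n).1
  have h8 : cart a1 a2 (k + 1) * x (k + 1) - x (k + 2) ≤ x k - 1 := by omega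
  have key : cgen a1 a2 s n * x (k + 1) ≤ cgen a1 a2 s (n + 1) * (x k - 1) := by
    push_cast at h6
    rw [show s + ((n : ℤ) + 1) + 2 = k + 2 by omega, show s + ((n : ℤ) + 1) + 1 = k + 1 by omega,
      cgen_succ_succ, show s + (n : ℤ) + 2 = k + 1 by omega] at h6
    nlinarith [mul_le_mul_of_nonneg_left h8 h7.le]
  have hpos : 0 ≤ x k - 1 := by
    have := mul_nonneg (ha.cgen_nonneg s n) (h2 (k + 1))
    by_contra hneg
    nlinarith
  refine ⟨fun l hl => ?_, fun l => ?_, fun j => ?_⟩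
  · simp [h1 l hl, show k ≠ l by omega]
  · simp only [Finsupp.sub_apply, single_apply]
    have := h2 l
    split
    · rename_i hkl
      rw [← hkl]
      omega
    · omega
  · have h3j := h3 j
    simp only [Finsupp.sub_apply, single_apply]
    by_cases hj : j = n
    · subst hj
      rw [if_neg (by omega), if_pos hn, ← hn, show s + (j : ℤ) + 2 = k + 1 by omega, sub_zero]
      exact key
    · rw [if_neg (show ¬ k = s + j + 1 by omega), sub_zero]
      have := ha.cgen_nonneg s j
      split
      · nlinarith
      · simpa using h3j

theorem StringData.cone (ha : Hyperbolic a1 a2) {s t : ℤ} {x m : ℤ →₀ ℤ}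
    (h : StringData a1 a2 s t x m) : Cone a1 a2 s m := by
  induction h with
  | zero => simp [Cone]
  | step h hk ih => exact ih.add_single ha hk
  | shift h he ih => exact ih

theorem sum_sub_single (x : ℤ →₀ ℤ) (k : ℤ) :
    ((x - single k 1).sum fun _ n => n) = (x.sum fun _ n => n) - 1 := by
  rw [Finsupp.sum_sub_index (by simp), Finsupp.sum_single_index rfl]

theorem Cone.exists_stringData (ha : Hyperbolic a1 a2) {s : ℤ} : ∀ (N : ℕ) {m : ℤ →₀ ℤ},
    Cone a1 a2 s m → (m.sum fun _ n => n) ≤ N → ∀ t, ∃ x, StringData a1 a2 s t x m := by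
  intro N
  induction N with
  | zero =>
    intro m hm hN t
    have hm0 : m = 0 := by
      have h0 : ∑ j ∈ m.support, m j = 0 :=
        le_antisymm (by exact_mod_cast hN) (Finset.sum_nonneg fun j _ => hm.2.1 j)
      rw [Finset.sum_eq_zero_iff_of_nonneg fun j _ => hm.2.1 j] at h0
      ext j
      by_cases hj : j ∈ m.support
      · simpa using h0 j hj
      · simpa using hj
    subst hm0
    exact ⟨0, .zero t⟩
  | succ N ih =>
    intro m hm hN t
    have lower : ∀ t k, LowersAt a1 a2 s (idx (t + 1)) m k → ∃ x, StringData a1 a2 s t x m := by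
      intro t k hk
      have hmk : m = (m - single k 1) + single k 1 := by simp
      obtain ⟨x, hx⟩ := ih (hm.of_lowersAt ha hk)
        (by rw [sum_sub_single]; push_cast at hN; omega) t
      rw [hmk]
      exact ⟨_, hx.step (hk.actsAt hmk)⟩
    obtain ⟨e, he⟩ := exists_isEps (a1 := a1) (a2 := a2) s (t + 1) m
    rcases he.nonneg.eq_or_lt with he0 | he0
    · subst he0
      by_cases hm0 : m = 0
      · subst hm0
        exact ⟨0, .zero t⟩
      have hne : m.support.Nonempty := Finsupp.support_nonempty_iff.2 hm0
      set k := m.support.max' hne with hk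
      have hmk : m k ≠ 0 := Finsupp.mem_support_iff.1 (m.support.max'_mem hne)
      have hks : s < k := by
        by_contra hks
        exact hmk (hm.1 k (by omega))
      have hσ : sg a1 a2 k m = m k := by
        have h1 := sg_sub_sg_add_two (a1 := a1) (a2 := a2) k m
        have hz : ∀ j, k < j → m j = 0 := fun j hj => by
          by_contra hj0
          exact absurd (m.support.le_max' j (Finsupp.mem_support_iff.2 hj0)) (by omega)
        rw [sg_eq_zero_of_large (k := k + 2) fun j hj => hz j (by omega), hz (k + 1) (by omega),
          hz (k + 2) (by omega)] at h1
        linarith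
      have hpos : 0 < m k := lt_of_le_of_ne (hm.2.1 k) hmk.symm
      have hki : idx (t + 1 + 1) = idx k := by
        have : idx k ≠ idx (t + 1) := fun h => by
          have := he.1 k hks h
          omega
        rw [Ne, idx_eq_idx] at this
        rw [idx_eq_idx]
        omega
      obtain ⟨e', he'⟩ := exists_isEps (a1 := a1) (a2 := a2) s (t + 1 + 1) m
      have := he'.1 k hks hki.symm
      obtain ⟨l, hl⟩ := he'.exists_lowersAt (by omega)
      obtain ⟨x, hx⟩ := lower (t + 1) l hl
      exact ⟨x, hx.shift he⟩
    · obtain ⟨k, hk⟩ := he.exists_lowersAt he0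
      exact lower t k hk

namespace Hyperbolic

theorem cgen_even_growth (ha : Hyperbolic a1 a2) (s : ℤ) (n : ℕ) :
    (gammaR a1 a2 s * gammaR a1 a2 (s + 1)) ^ n ≤ cgen a1 a2 s (2 * n + 2) := by
  induction n with
  | zero =>
    have h1 := ha.1
    have h2 := ha.2.1
    have : 1 ≤ cgen a1 a2 s 2 := by
      simp only [cgen, cart]
      split <;> omega
    simpa using (by exact_mod_cast this : (1 : ℝ) ≤ cgen a1 a2 s 2)
  | succ n ih =>
    have g1 := (ha.cgen_growth s (2 * n + 2)).2
    have g2 := (ha.cgen_growth s (2 * n + 3)).2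
    have e1 : ∀ j : ℕ, gammaR a1 a2 (s + (2 * j + 2 : ℕ) + 1) = gammaR a1 a2 (s + 1) := by
      intro j
      unfold gammaR
      rw [show (s + (2 * j + 2 : ℕ) + 1) % 2 = (s + 1) % 2 by push_cast; omega]
    have e2 : ∀ j : ℕ, gammaR a1 a2 (s + (2 * j + 3 : ℕ) + 1) = gammaR a1 a2 s := by
      intro j
      unfold gammaR
      rw [show (s + (2 * j + 3 : ℕ) + 1) % 2 = s % 2 by push_cast; omega]
    rw [e1] at g1
    rw [e2] at g2
    have p1 := ha.gammaR_pos s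
    have p2 := ha.gammaR_pos (s + 1)
    calc (gammaR a1 a2 s * gammaR a1 a2 (s + 1)) ^ (n + 1)
        = gammaR a1 a2 s * (gammaR a1 a2 (s + 1) *
            (gammaR a1 a2 s * gammaR a1 a2 (s + 1)) ^ n) := by ring
      _ ≤ gammaR a1 a2 s * (gammaR a1 a2 (s + 1) * cgen a1 a2 s (2 * n + 2)) := by gcongr
      _ ≤ gammaR a1 a2 s * cgen a1 a2 s (2 * n + 3) := by gcongr
      _ ≤ cgen a1 a2 s (2 * (n + 1) + 2) := g2

/-- The defect in the growth estimate of `cgen` shrinks. -/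
theorem cgen_defect (ha : Hyperbolic a1 a2) (s : ℤ) (n : ℕ) :
    (cgen a1 a2 s (n + 2) : ℝ) - gammaR a1 a2 (s + n + 2) * cgen a1 a2 s (n + 1) =
      (cart a1 a2 (s + n + 2) - gammaR a1 a2 (s + n + 2)) *
        (cgen a1 a2 s (n + 1) - gammaR a1 a2 (s + n + 1) * cgen a1 a2 s n) := by
  have h := ha.gammaR_mul_sub (s + n + 1)
  rw [show s + (n : ℤ) + 1 + 1 = s + n + 2 by ring] at h
  rw [cgen_succ_succ]
  push_cast
  linear_combination (cgen a1 a2 s n : ℝ) * h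

theorem cgen_defect_le (ha : Hyperbolic a1 a2) (s : ℤ) (n : ℕ) :
    (cgen a1 a2 s (2 * n + 1) : ℝ) - gammaR a1 a2 (s + 1) * cgen a1 a2 s (2 * n) ≤ 1 := by
  induction n with
  | zero => simp [cgen]
  | succ n ih =>
    have d1 := ha.cgen_defect s (2 * n)
    have d2 := ha.cgen_defect s (2 * n + 1)
    have hg1 : gammaR a1 a2 (s + (2 * n : ℕ) + 1) = gammaR a1 a2 (s + 1) := by
      unfold gammaR
      rw [show (s + (2 * n : ℕ) + 1) % 2 = (s + 1) % 2 by push_cast; omega]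
    have hg0 : gammaR a1 a2 (s + (2 * n : ℕ) + 2) = gammaR a1 a2 s := by
      unfold gammaR
      rw [show (s + (2 * n : ℕ) + 2) % 2 = s % 2 by push_cast; omega]
    have hc0 : cart a1 a2 (s + (2 * n : ℕ) + 2) = cart a1 a2 s := by
      unfold cart
      rw [show (s + (2 * n : ℕ) + 2) % 2 = s % 2 by push_cast; omega]
    have hc1 : cart a1 a2 (s + (2 * n + 1 : ℕ) + 2) = cart a1 a2 (s + 1) := by
      unfold cart
      rw [show (s + (2 * n + 1 : ℕ) + 2) % 2 = (s + 1) % 2 by push_cast; omega]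
    have hg2 : gammaR a1 a2 (s + (2 * n + 1 : ℕ) + 2) = gammaR a1 a2 (s + 1) := by
      unfold gammaR
      rw [show (s + (2 * n + 1 : ℕ) + 2) % 2 = (s + 1) % 2 by push_cast; omega]
    have hg3 : gammaR a1 a2 (s + (2 * n + 1 : ℕ) + 1) = gammaR a1 a2 s := by
      unfold gammaR
      rw [show (s + (2 * n + 1 : ℕ) + 1) % 2 = s % 2 by push_cast; omega]
    rw [hg1, hg0, hc0] at d1
    rw [hg2, hg3, hc1, d1] at d2
    have m1 := ha.gammaR_mul_sub s
    have m2 := ha.gammaR_mul_sub (s + 1)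
    rw [show s + 1 + 1 = s + 2 by ring, gammaR_add_two, cart_add_two] at m2
    have p1 := ha.gammaR_pos s
    have p2 := ha.gammaR_pos (s + 1)
    have hm := ha.one_lt_gammaR_mul s
    set A := (cart a1 a2 s : ℝ) - gammaR a1 a2 s
    set B := (cart a1 a2 (s + 1) : ℝ) - gammaR a1 a2 (s + 1)
    have hA : 0 < A := by by_contra hn; nlinarith
    have hB : 0 < B := by by_contra hn; nlinarith
    have hBA : B * A ≤ 1 := by
      have h1 : (B * A) * (gammaR a1 a2 s * gammaR a1 a2 (s + 1)) = 1 := by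
        linear_combination gammaR a1 a2 s * B * m2 + m1
      nlinarith [mul_pos hB hA]
    have hD0 : (0 : ℝ) ≤ cgen a1 a2 s (2 * n + 1) - gammaR a1 a2 (s + 1) * cgen a1 a2 s (2 * n) := by
      have := (ha.cgen_growth s (2 * n)).2
      rw [hg1] at this
      linarith
    rw [show 2 * (n + 1) + 1 = 2 * n + 1 + 2 by ring, show 2 * (n + 1) = 2 * n + 1 + 1 by ring, d2,
      ← mul_assoc]
    nlinarith [mul_pos hB hA]

/-- The cone inequalities starting from all positions to the left give the limiting
inequality. -/
theorem le_gammaR_mul (ha : Hyperbolic a1 a2) {U : ℤ → ℤ} {k t0 : ℤ} (hU : 0 ≤ U k)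
    (h : ∀ t ≤ t0, ∀ n : ℕ, k = t + n + 1 →
      cgen a1 a2 t n * U (k + 1) ≤ cgen a1 a2 t (n + 1) * U k) :
    (U (k + 1) : ℝ) ≤ gammaR a1 a2 k * U k := by
  by_contra! hlt
  set δ := (U (k + 1) : ℝ) - gammaR a1 a2 k * U k with hδ
  have hδ0 : 0 < δ := by linarith
  have hm := ha.one_lt_gammaR_mul (k + 1)
  obtain ⟨n, hn⟩ := pow_unbounded_of_one_lt (U k / δ) hm
  set N := n + (k - t0).toNat with hN
  have hNn := hn.trans_le (pow_le_pow_right₀ hm.le (show n ≤ N by omega))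
  have hh := h (k - (2 * N + 2 : ℕ) - 1) (by omega) (2 * N + 2) (by omega)
  set t := k - (2 * N + 2 : ℕ) - 1 with ht
  have hg := ha.cgen_even_growth t N
  have e0 : gammaR a1 a2 t = gammaR a1 a2 (k + 1) := by
    unfold gammaR
    rw [show t % 2 = (k + 1) % 2 by omega]
  have e1 : gammaR a1 a2 (t + 1) = gammaR a1 a2 k := by
    unfold gammaR
    rw [show (t + 1) % 2 = k % 2 by omega]
  have e2 : gammaR a1 a2 (k + 1 + 1) = gammaR a1 a2 k := by
    unfold gammaR
    rw [show (k + 1 + 1) % 2 = k % 2 by omega]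
  have hd := ha.cgen_defect_le t (N + 1)
  rw [e1, show 2 * (N + 1) = 2 * N + 2 by ring] at hd
  rw [e0, e1] at hg
  rw [e2] at hNn
  have hh' : (cgen a1 a2 t (2 * N + 2) : ℝ) * U (k + 1) ≤ cgen a1 a2 t (2 * N + 2 + 1) * U k := by
    exact_mod_cast hh
  have hU' : (0 : ℝ) ≤ U k := by exact_mod_cast hU
  have h1 : (cgen a1 a2 t (2 * N + 2) : ℝ) * δ ≤ U k := by
    have := mul_le_mul_of_nonneg_right hd hU'
    rw [hδ]
    linarith
  have h2 := (div_lt_iff₀ hδ0).1 (hNn.trans_le hg)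
  linarith

end Hyperbolic

theorem finsum_mul_coe (g : ℤ → ℤ) (z : ℤ →₀ ℤ) :
    ∑ᶠ j, g j * z j = z.sum fun j n => g j * n := by
  refine finsum_eq_sum_of_support_subset _ fun j hj => ?_
  simp only [Function.mem_support] at hj
  simpa using right_ne_zero_of_mul hj

theorem tot_add (i : ℤ) (x y : ℤ →₀ ℤ) : tot a1 a2 i (x + y) = tot a1 a2 i x + tot a1 a2 i y := by
  unfold tot
  exact Finsupp.sum_add_index' (by simp) (by intros; ring)

theorem tot_single (i l c : ℤ) : tot a1 a2 i (single l c) = pairJI a1 a2 l i * c := by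
  unfold tot
  rw [Finsupp.sum_single_index (by simp)]

theorem sg_sub (k : ℤ) (x y : ℤ →₀ ℤ) : sg a1 a2 k (x - y) = sg a1 a2 k x - sg a1 a2 k y := by
  have := sg_add (a1 := a1) (a2 := a2) k (x - y) y
  rw [sub_add_cancel] at this
  omega

theorem tot_sub (i : ℤ) (x y : ℤ →₀ ℤ) : tot a1 a2 i (x - y) = tot a1 a2 i x - tot a1 a2 i y := by
  have := tot_add (a1 := a1) (a2 := a2) i (x - y) y
  rw [sub_add_cancel] at this
  omega

@[simp] theorem tot_zero (i : ℤ) : tot a1 a2 i 0 = 0 := by simp [tot]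

theorem sigmaP_coe (z : ℤ →₀ ℤ) (k : ℤ) : sigmaP a1 a2 z k = sg a1 a2 k z := by
  have h : ∀ j, (if k < j then pairJK a1 a2 j k * z j else 0) =
      (if k < j then pairJK a1 a2 j k else 0) * z j := fun j => by split <;> simp
  unfold sigmaP
  simp only [h]
  rw [finsum_mul_coe]
  clear h
  induction z using Finsupp.induction_linear with
  | zero => simp
  | add x y hx hy =>
    rw [sg_add, ← hx, ← hy, Finsupp.sum_add_index' (by simp) (by intros; ring)]
    simp only [Finsupp.add_apply]
    ring
  | single l c =>
    rw [sg_single, Finsupp.sum_single_index (by simp)]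
    simp only [wgt, single_apply]
    split
    · subst l
      simp
    · simp

theorem sigmaM_coe (z : ℤ →₀ ℤ) (k : ℤ) :
    sigmaM a1 a2 z k = sg a1 a2 k z - tot a1 a2 (idx k) z := by
  have h : ∀ j, (if j < k then pairJK a1 a2 j k * z j else 0) =
      (if j < k then pairJK a1 a2 j k else 0) * z j := fun j => by split <;> simp
  unfold sigmaM
  simp only [h]
  rw [finsum_mul_coe]
  clear h
  induction z using Finsupp.induction_linear with
  | zero => simp
  | add x y hx hy =>
    rw [sg_add, tot_add, Finsupp.sum_add_index' (by simp) (by intros; ring)]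
    simp only [Finsupp.add_apply]
    linear_combination hx + hy
  | single l c =>
    rw [sg_single, tot_single, Finsupp.sum_single_index (by simp), pairJI_idx]
    simp only [wgt, single_apply]
    rcases lt_trichotomy l k with h | rfl | h
    · simp [h, h.ne, h.not_gt]
    · simp [pairJK]
      ring
    · simp [h, h.ne', h.not_gt]

theorem pairW_wtOf_coe (z : ℤ →₀ ℤ) {i : ℤ} (hi : IsI i) :
    pairW (wtOf a1 a2 z) i = -tot a1 a2 i z := by
  have h1 : ∀ j, (alphaOf a1 a2 j).1 = pairJI a1 a2 j 1 := fun j => by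
    unfold alphaOf pairJI idx
    split <;> simp
  have h2 : ∀ j, (alphaOf a1 a2 j).2 = pairJI a1 a2 j 2 := fun j => by
    unfold alphaOf pairJI idx
    split <;> simp
  unfold wtOf tot
  simp only [h1, h2, mul_comm (z _), finsum_mul_coe]
  rcases hi with rfl | rfl <;> simp [pairW]

theorem pairW_add (μ ν : ℤ × ℤ) (i : ℤ) : pairW (μ + ν) i = pairW μ i + pairW ν i := by
  unfold pairW
  split <;> simp

theorem pairW_wtZ_coe (μ : ℤ × ℤ) (z : ℤ →₀ ℤ) {i : ℤ} (hi : IsI i) :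
    pairW (wtZ a1 a2 μ z) i = pairW μ i - tot a1 a2 i z := by
  rw [wtZ, pairW_add, pairW_wtOf_coe z hi, sub_eq_add_neg]

theorem sigmaZ_coe (μ : ℤ × ℤ) (z : ℤ →₀ ℤ) (k : ℤ) :
    sigmaZ a1 a2 μ z k = sg a1 a2 k z - if 1 ≤ k then 0 else pairW μ (idx k) := by
  unfold sigmaZ
  split
  · rw [sigmaP_coe, sub_zero]
  · rw [sigmaM_coe, pairW_wtZ_coe μ z (idx_isI k)]
    ring

theorem epsZ_eq {μ : ℤ × ℤ} {x : ℤ → ℤ} {k : ℤ}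
    (h : ∀ l, idx l = idx k → sigmaZ a1 a2 μ x l ≤ sigmaZ a1 a2 μ x k) :
    epsZ a1 a2 μ x (idx k) = sigmaZ a1 a2 μ x k :=
  IsGreatest.csSup_eq ⟨⟨k, rfl, rfl⟩, by rintro _ ⟨l, hl, rfl⟩; exact h l hl⟩

theorem fZ_eq_some {μ : ℤ × ℤ} {x : ℤ → ℤ} {k : ℤ}
    (h : ∀ l, idx l = idx k → sigmaZ a1 a2 μ x l ≤ sigmaZ a1 a2 μ x k)
    (hmin : ∀ l < k, idx l = idx k → sigmaZ a1 a2 μ x l < sigmaZ a1 a2 μ x k)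
    (hpos : 0 < sigmaZ a1 a2 μ x k + pairW (wtZ a1 a2 μ x) (idx k)) :
    fZ a1 a2 μ (idx k) x = some (Function.update x k (x k + 1)) := by
  have hk : kminZ a1 a2 μ x (idx k) = k := by
    unfold kminZ
    rw [epsZ_eq h]
    refine IsLeast.csInf_eq ⟨⟨rfl, rfl⟩, fun l hl => ?_⟩
    by_contra hlk
    exact (hmin l (by omega) hl.1).ne hl.2
  rw [fZ, phiZ, epsZ_eq h, if_pos hpos, hk]

theorem eZ_eq_some {μ : ℤ × ℤ} {x : ℤ → ℤ} {k : ℤ}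
    (h : ∀ l, idx l = idx k → sigmaZ a1 a2 μ x l ≤ sigmaZ a1 a2 μ x k)
    (hmax : ∀ l, k < l → idx l = idx k → sigmaZ a1 a2 μ x l < sigmaZ a1 a2 μ x k)
    (hpos : 0 < sigmaZ a1 a2 μ x k) :
    eZ a1 a2 μ (idx k) x = some (Function.update x k (x k - 1)) := by
  have hk : kmaxZ a1 a2 μ x (idx k) = k := by
    unfold kmaxZ
    rw [epsZ_eq h]
    refine IsGreatest.csSup_eq ⟨⟨rfl, rfl⟩, fun l hl => ?_⟩
    by_contra hlk
    exact (hmax l (by omega) hl.1).ne hl.2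
  rw [eZ, epsZ_eq h, if_pos hpos, hk]

theorem update_coe (z : ℤ →₀ ℤ) (k c : ℤ) :
    Function.update (z : ℤ → ℤ) k (z k + c) = (z + single k c : ℤ →₀ ℤ) := by
  ext l
  rw [Finsupp.add_apply, single_apply, Function.update_apply]
  by_cases h : k = l
  · subst h; simp
  · simp [h, Ne.symm h]

theorem fP_coe {z : ℤ →₀ ℤ} {i k : ℤ} (h : ActsAt a1 a2 0 i z k) :
    fP a1 a2 i z = (z + single k 1 : ℤ →₀ ℤ) := by
  obtain ⟨hk, rfl, hmax, hmin⟩ := h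
  have he : epsP a1 a2 z (idx k) = sg a1 a2 k z :=
    IsGreatest.csSup_eq ⟨⟨k, by omega, rfl, sigmaP_coe z k⟩, by
      rintro _ ⟨l, hl, hli, rfl⟩
      rw [sigmaP_coe]
      exact hmax l (by omega) hli⟩
  have hk' : kminP a1 a2 z (idx k) = k := by
    unfold kminP
    rw [he]
    refine IsLeast.csInf_eq ⟨⟨by omega, rfl, sigmaP_coe z k⟩, fun l hl => ?_⟩
    by_contra hlk
    have := hl.2.2
    rw [sigmaP_coe] at this
    exact (hmin l (by have := hl.1; omega) (by omega) hl.2.1).ne this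
  rw [fP, hk', update_coe]

/-- Reflection `x_k ↦ x_{-k}` of finitely supported sequences. -/
noncomputable def reflect (x : ℤ →₀ ℤ) : ℤ →₀ ℤ := x.equivMapDomain (Equiv.neg ℤ)

@[simp] theorem reflect_apply (x : ℤ →₀ ℤ) (k : ℤ) : reflect x k = x (-k) := rfl

theorem reflect_add (x y : ℤ →₀ ℤ) : reflect (x + y) = reflect x + reflect y := by
  ext k; simp

theorem reflect_sub (x y : ℤ →₀ ℤ) : reflect (x - y) = reflect x - reflect y := by
  ext k; simp

theorem reflect_single (l c : ℤ) : reflect (single l c) = single (-l) c := by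
  ext k; simp [single_apply, show l = -k ↔ -l = k by omega]

@[simp] theorem reflect_zero : reflect 0 = 0 := by ext k; simp

theorem idx_neg (k : ℤ) : idx (-k) = idx k := by rw [idx_eq_idx]; omega

theorem sg_reflect (k : ℤ) (x : ℤ →₀ ℤ) :
    sg a1 a2 k (reflect x) = tot a1 a2 (idx k) x - sg a1 a2 (-k) x := by
  induction x using Finsupp.induction_linear with
  | zero => simp
  | add x y hx hy => rw [reflect_add, sg_add, sg_add, tot_add, hx, hy]; ring
  | single l c =>
    rw [reflect_single, sg_single, sg_single, tot_single, pairJI_idx]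
    have hp : pairJK a1 a2 (-l) k = pairJK a1 a2 l k := by
      unfold pairJK
      rw [show -l % 2 = l % 2 by omega]
    have hp' : pairJK a1 a2 l (-k) = pairJK a1 a2 l k := by
      unfold pairJK
      rw [show -k % 2 = k % 2 by omega]
    unfold wgt
    rw [hp, hp']
    rcases lt_trichotomy (-l) k with h | h | h
    · simp [show -l ≠ k by omega, show ¬ k < -l by omega, show l ≠ -k by omega,
        show -k < l by omega]
    · simp [show l = -k by omega, pairJK, show -k % 2 = k % 2 by omega]
      ring
    · simp [show -l ≠ k by omega, show k < -l by omega, show l ≠ -k by omega,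
        show ¬ -k < l by omega]

theorem tot_reflect (i : ℤ) (x : ℤ →₀ ℤ) : tot a1 a2 i (reflect x) = tot a1 a2 i x := by
  induction x using Finsupp.induction_linear with
  | zero => simp
  | add x y hx hy => rw [reflect_add, tot_add, tot_add, hx, hy]
  | single l c => rw [reflect_single, tot_single, tot_single, pairJI_congr (idx_neg l)]

theorem eM_coe {z : ℤ →₀ ℤ} {i k : ℤ} (h : ActsAt a1 a2 (-1) i z k) :
    eM a1 a2 i (-reflect z : ℤ →₀ ℤ) = (-reflect (z + single k 1) : ℤ →₀ ℤ) := by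
  obtain ⟨hk, rfl, hmax, hmin⟩ := h
  have hs : ∀ l, sigmaM a1 a2 (-reflect z : ℤ →₀ ℤ) l = sg a1 a2 (-l) z := fun l => by
    rw [sigmaM_coe, ← zero_sub, sg_sub, tot_sub, sg_reflect, tot_reflect]
    simp
  have he : phiMf a1 a2 (-reflect z : ℤ →₀ ℤ) (idx k) = sg a1 a2 k z :=
    IsGreatest.csSup_eq ⟨⟨-k, by omega, idx_neg k, by rw [hs, neg_neg]⟩, by
      rintro _ ⟨l, hl, hli, rfl⟩
      rw [hs]
      exact hmax (-l) (by omega) (by rw [idx_neg, hli])⟩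
  have hk' : kmaxM a1 a2 (-reflect z : ℤ →₀ ℤ) (idx k) = -k := by
    unfold kmaxM
    rw [he]
    refine IsGreatest.csSup_eq ⟨⟨by omega, idx_neg k, by rw [hs, neg_neg]⟩, fun l hl => ?_⟩
    by_contra hlk
    have := hl.2.2
    rw [hs] at this
    exact (hmin (-l) (by have := hl.1; omega) (by omega) (by rw [idx_neg, hl.2.1])).ne this
  rw [eM, hk', sub_eq_add_neg, update_coe, reflect_add, reflect_single]
  congr 1
  ext l
  simp [single_apply]
  split <;> ring

section Pair

/-- The element of `Z_ι(μ)` with components `b` and `-d` (reflected). -/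
noncomputable def pr (b d : ℤ →₀ ℤ) : ℤ →₀ ℤ := b - reflect d

theorem sigmaZ_pr_of_pos (μ : ℤ × ℤ) {b d : ℤ →₀ ℤ} (hd : ∀ k ≤ -1, d k = 0) {k : ℤ}
    (hk : 0 < k) : sigmaZ a1 a2 μ (pr b d) k = sg a1 a2 k b := by
  rw [sigmaZ_coe, if_pos (by omega), pr, sg_sub, sg_eq_zero_of_large (x := reflect d)]
  · ring
  · intro j hj
    rw [reflect_apply]
    exact hd _ (by omega)

theorem sigmaZ_pr_neg (μ : ℤ × ℤ) {b d : ℤ →₀ ℤ} (hb : ∀ k ≤ 0, b k = 0) {k : ℤ}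
    (hk : -1 < k) : sigmaZ a1 a2 μ (pr b d) (-k) =
      sg a1 a2 k d - (pairW μ (idx k) - tot a1 a2 (idx k) b + tot a1 a2 (idx k) d) := by
  have hb' : sg a1 a2 (-k) b = tot a1 a2 (idx k) b := by
    have := sg_add_apply (a1 := a1) (a2 := a2) (x := b) (k := -k) fun j hj => hb j (by omega)
    rw [hb _ (by omega), idx_neg] at this
    omega
  rw [sigmaZ_coe, if_neg (by omega), pr, sg_sub, sg_reflect, hb', idx_neg, neg_neg]
  ring

theorem pairW_wtZ_pr (μ : ℤ × ℤ) (b d : ℤ →₀ ℤ) {i : ℤ} (hi : IsI i) :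
    pairW (wtZ a1 a2 μ (pr b d)) i = pairW μ i - tot a1 a2 i b + tot a1 a2 i d := by
  rw [pairW_wtZ_coe μ _ hi, pr, tot_sub, tot_reflect]
  ring

end Pair

/-- The tensor product rule: `op` acts on pairs `(b, d)` by raising `b` or lowering `d`. -/
structure TensorRule (a1 a2 s s' : ℤ) (mk : (ℤ →₀ ℤ) → (ℤ →₀ ℤ) → ℤ → ℤ)
    (op : ℤ → (ℤ → ℤ) → Option (ℤ → ℤ)) (ν : ℤ → ℤ) : Prop where
  raise : ∀ {i k rb rd : ℤ} {b d : ℤ →₀ ℤ}, (∀ l ≤ s, b l = 0) → (∀ l ≤ s', d l = 0) →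
    IsEps a1 a2 s i b rb → IsEps a1 a2 s' i d rd →
    rd < rb + (ν i - tot a1 a2 i b + tot a1 a2 i d) → ActsAt a1 a2 s i b k →
    op i (mk b d) = some (mk (b + single k 1) d)
  lower : ∀ {i k rb rd : ℤ} {b d : ℤ →₀ ℤ}, (∀ l ≤ s, b l = 0) → (∀ l ≤ s', d l = 0) →
    IsEps a1 a2 s i b rb → IsEps a1 a2 s' i d rd →
    rb + (ν i - tot a1 a2 i b + tot a1 a2 i d) ≤ rd → LowersAt a1 a2 s' i d k →
    op i (mk b d) = some (mk b (d - single k 1))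

theorem pr_add_left (b d : ℤ →₀ ℤ) (k : ℤ) :
    Function.update (pr b d : ℤ → ℤ) k (pr b d k + 1) = pr (b + single k 1) d := by
  rw [update_coe, pr, pr]
  congr 1
  abel

theorem pr_sub_right (b d : ℤ →₀ ℤ) (k : ℤ) :
    Function.update (pr b d : ℤ → ℤ) (-k) (pr b d (-k) + 1) = pr b (d - single k 1) := by
  rw [update_coe, pr, pr, reflect_sub, reflect_single]
  congr 1
  abel

theorem pr_sub_left (b d : ℤ →₀ ℤ) (k : ℤ) :
    Function.update (pr b d : ℤ → ℤ) k (pr b d k - 1) = pr (b - single k 1) d := by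
  rw [sub_eq_add_neg, update_coe, single_neg, pr, pr]
  congr 1
  abel

theorem pr_add_right (b d : ℤ →₀ ℤ) (k : ℤ) :
    Function.update (pr b d : ℤ → ℤ) (-k) (pr b d (-k) - 1) = pr b (d + single k 1) := by
  rw [sub_eq_add_neg, update_coe, single_neg, pr, pr, reflect_add, reflect_single]
  congr 1
  abel

theorem tensorRule_fZ (μ : ℤ × ℤ) : TensorRule a1 a2 0 (-1) (fun b d => pr b d)
    (fZ a1 a2 μ) (pairW μ) where
  raise := by
    intro i k rb rd b d hb hd hεb hεd hlt hk
    obtain rfl := hεb.unique hk.isEps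
    have h0 := hεd.nonneg
    obtain ⟨hk0, rfl, hmax, hmin⟩ := hk
    have hneg : ∀ l, ¬ 0 < l → idx l = idx k →
        sigmaZ a1 a2 μ (pr b d) l < sg a1 a2 k b := fun l hl hli => by
      have := sigmaZ_pr_neg (a1 := a1) (a2 := a2) μ (d := d) hb (show -1 < -l by omega)
      rw [neg_neg, idx_neg, hli] at this
      have := hεd.1 (-l) (by omega) (by rw [idx_neg, hli])
      omega
    rw [← pr_add_left]
    refine fZ_eq_some (fun l hli => ?_) (fun l hl hli => ?_) ?_
    · rw [sigmaZ_pr_of_pos μ hd hk0]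
      by_cases hl0 : 0 < l
      · rw [sigmaZ_pr_of_pos μ hd hl0]
        exact hmax l hl0 hli
      · exact (hneg l hl0 hli).le
    · rw [sigmaZ_pr_of_pos μ hd hk0]
      by_cases hl0 : 0 < l
      · rw [sigmaZ_pr_of_pos μ hd hl0]
        exact hmin l hl0 hl hli
      · exact hneg l hl0 hli
    · rw [sigmaZ_pr_of_pos μ hd hk0, pairW_wtZ_pr μ b d (idx_isI k)]
      omega
  lower := by
    intro i k rb rd b d hb hd hεb hεd hlt hk
    obtain rfl := hεd.unique hk.isEps
    obtain ⟨hk0, rfl, hmax, hpos, hlast⟩ := hk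
    rw [← pr_sub_right, ← idx_neg k]
    have hσ := sigmaZ_pr_neg (a1 := a1) (a2 := a2) μ (d := d) hb hk0
    have hlneg : ∀ l, ¬ 0 < l → idx l = idx k → sigmaZ a1 a2 μ (pr b d) l =
        sg a1 a2 (-l) d - (pairW μ (idx k) - tot a1 a2 (idx k) b + tot a1 a2 (idx k) d) := by
      intro l hl hli
      have := sigmaZ_pr_neg (a1 := a1) (a2 := a2) μ (d := d) hb (show -1 < -l by omega)
      rwa [neg_neg, idx_neg, hli] at this
    refine fZ_eq_some (fun l hli => ?_) (fun l hl hli => ?_) ?_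
    · rw [idx_neg] at hli
      by_cases hl0 : 0 < l
      · rw [sigmaZ_pr_of_pos μ hd hl0]
        have := hεb.1 l hl0 hli
        omega
      · have := hlneg l hl0 hli
        have := hmax (-l) (by omega) (by rw [idx_neg, hli])
        omega
    · rw [idx_neg] at hli
      have := hlneg l (by omega) hli
      have := hlast (-l) (by omega) (by rw [idx_neg, hli])
      omega
    · rw [hσ, pairW_wtZ_pr μ b d (idx_isI _), idx_neg]
      omega

theorem tensorRule_eZ (μ : ℤ × ℤ) : TensorRule a1 a2 (-1) 0 (fun d b => pr b d)
    (eZ a1 a2 μ) (fun i => -pairW μ i) where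
  raise := by
    intro i k rd rb d b hd hb hεd hεb hlt hk
    obtain rfl := hεd.unique hk.isEps
    have h0 := hεb.nonneg
    obtain ⟨hk0, rfl, hmax, hmin⟩ := hk
    rw [← pr_add_right, ← idx_neg k]
    have hσ := sigmaZ_pr_neg (a1 := a1) (a2 := a2) μ (d := d) hb hk0
    have hlneg : ∀ l, ¬ 0 < l → idx l = idx k → sigmaZ a1 a2 μ (pr b d) l =
        sg a1 a2 (-l) d - (pairW μ (idx k) - tot a1 a2 (idx k) b + tot a1 a2 (idx k) d) := by
      intro l hl hli
      have := sigmaZ_pr_neg (a1 := a1) (a2 := a2) μ (d := d) hb (show -1 < -l by omega)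
      rwa [neg_neg, idx_neg, hli] at this
    have hlpos : ∀ l, 0 < l → idx l = idx k →
        sigmaZ a1 a2 μ (pr b d) l < sigmaZ a1 a2 μ (pr b d) (-k) := fun l hl hli => by
      rw [sigmaZ_pr_of_pos μ hd hl]
      have := hεb.1 l hl hli
      omega
    refine eZ_eq_some (fun l hli => ?_) (fun l hl hli => ?_) (by omega)
    · rw [idx_neg] at hli
      by_cases hl0 : 0 < l
      · exact (hlpos l hl0 hli).le
      · have := hlneg l hl0 hli
        have := hmax (-l) (by omega) (by rw [idx_neg, hli])
        omega
    · rw [idx_neg] at hli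
      by_cases hl0 : 0 < l
      · exact hlpos l hl0 hli
      · have := hlneg l hl0 hli
        have := hmin (-l) (by omega) (by omega) (by rw [idx_neg, hli])
        omega
  lower := by
    intro i k rd rb d b hd hb hεd hεb hlt hk
    obtain rfl := hεb.unique hk.isEps
    obtain ⟨hk0, rfl, hmax, hpos, hlast⟩ := hk
    have hneg : ∀ l, ¬ 0 < l → idx l = idx k →
        sigmaZ a1 a2 μ (pr b d) l ≤ sg a1 a2 k b := fun l hl hli => by
      have := sigmaZ_pr_neg (a1 := a1) (a2 := a2) μ (d := d) hb (show -1 < -l by omega)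
      rw [neg_neg, idx_neg, hli] at this
      have := hεd.1 (-l) (by omega) (by rw [idx_neg, hli])
      omega
    rw [← pr_sub_left]
    refine eZ_eq_some (fun l hli => ?_) (fun l hl hli => ?_) ?_
    · rw [sigmaZ_pr_of_pos μ hd hk0]
      by_cases hl0 : 0 < l
      · rw [sigmaZ_pr_of_pos μ hd hl0]
        exact hmax l hl0 hli
      · exact hneg l hl0 hli
    · rw [sigmaZ_pr_of_pos μ hd hk0, sigmaZ_pr_of_pos μ hd (hk0.trans hl)]
      exact hlast l hl hli
    · rwa [sigmaZ_pr_of_pos μ hd hk0]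

namespace TensorRule

variable {s s' : ℤ} {mk : (ℤ →₀ ℤ) → (ℤ →₀ ℤ) → ℤ → ℤ}
  {op op' : ℤ → (ℤ → ℤ) → Option (ℤ → ℤ)} {ν : ℤ → ℤ}

theorem of_eq_none (h : TensorRule a1 a2 s s' mk op ν) {i rb rd : ℤ} {b d : ℤ →₀ ℤ}
    (hb : ∀ l ≤ s, b l = 0) (hd : ∀ l ≤ s', d l = 0) (hεb : IsEps a1 a2 s i b rb)
    (hεd : IsEps a1 a2 s' i d rd) (hn : op i (mk b d) = none) :
    rb + (ν i - tot a1 a2 i b + tot a1 a2 i d) ≤ 0 ∧ rd = 0 := by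
  have h1 : rb + (ν i - tot a1 a2 i b + tot a1 a2 i d) ≤ rd := by
    by_contra hlt
    obtain ⟨k, hk⟩ := hεb.exists_actsAt
    have := h.raise hb hd hεb hεd (by omega) hk
    simp [hn] at this
  have h2 : rd = 0 := by
    by_contra hne
    have := hεd.nonneg
    obtain ⟨k, hk⟩ := hεd.exists_lowersAt (by omega)
    have := h.lower hb hd hεb hεd h1 hk
    simp [hn] at this
  omega

theorem iterate_raise (h : TensorRule a1 a2 s s' mk op ν) {t t' : ℤ} {Y d : ℤ →₀ ℤ}
    (hd : StringData a1 a2 s' t' Y d) (htt : idx (t' + 1) = idx (t + 1)) (N : ℕ) :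
    ∀ {X b : ℤ →₀ ℤ}, StringData a1 a2 s t X b →
      X (t + 1) + (ν (idx (t + 1)) - tot a1 a2 (idx (t + 1)) b + tot a1 a2 (idx (t + 1)) d) =
        Y (t' + 1) + N →
      ∃ b', StringData a1 a2 s t (X + single (t + 1) (N : ℤ)) b' ∧
        (fun o => o.bind (op (idx (t + 1))))^[N] (some (mk b d)) = some (mk b' d) := by
  induction N with
  | zero =>
    intro X b hb _
    exact ⟨b, by simpa using hb, rfl⟩
  | succ N ih =>
    intro X b hb hN
    obtain ⟨k, hk⟩ := hb.isEps.exists_actsAt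
    have hop := h.raise hb.eq_zero_of_le' hd.eq_zero_of_le' hb.isEps (htt ▸ hd.isEps)
      (by push_cast at hN; omega) hk
    obtain ⟨b', hb', hit⟩ := ih (hb.step hk) (by
      rw [tot_add_single, pairJI_congr hk.2.1, pairJI_idx, pairJK, if_pos rfl]
      simp only [Finsupp.add_apply, single_apply, if_true]
      push_cast at hN
      omega)
    refine ⟨b', ?_, ?_⟩
    · rw [add_assoc, ← single_add] at hb'
      push_cast
      rwa [add_comm (N : ℤ)]
    · rw [Function.iterate_succ_apply, Option.bind_some, hop, hit]

theorem iterate_lower (h : TensorRule a1 a2 s s' mk op ν) {t t' : ℤ} {X b : ℤ →₀ ℤ}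
    (hb : StringData a1 a2 s t X b) (htt : idx (t' + 1) = idx (t + 1)) (N : ℕ) :
    ∀ {Y d : ℤ →₀ ℤ}, StringData a1 a2 s' t' Y d → Y (t' + 1) = N →
      X (t + 1) + (ν (idx (t + 1)) - tot a1 a2 (idx (t + 1)) b + tot a1 a2 (idx (t + 1)) d) ≤ N →
      ∃ d', StringData a1 a2 s' t' (Y - single (t' + 1) (N : ℤ)) d' ∧
        (fun o => o.bind (op (idx (t + 1))))^[N] (some (mk b d)) = some (mk b d') := by
  induction N with
  | zero =>
    intro Y d hd _ _
    exact ⟨d, by simpa using hd, rfl⟩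
  | succ N ih =>
    intro Y d hd hY hN
    have hεd := hd.isEps
    rw [hY] at hεd
    obtain ⟨k, hk⟩ := hεd.exists_lowersAt (by positivity)
    have hdk : d = (d - single k 1) + single k 1 := by simp
    have hact := hk.actsAt hdk
    have hop := h.lower hb.eq_zero_of_le' hd.eq_zero_of_le' hb.isEps (htt ▸ hεd) hN (htt ▸ hk)
    obtain ⟨d', hd', hit⟩ := ih (hd.pop hdk hact) (by
        simp only [Finsupp.sub_apply, single_apply, if_true]
        push_cast at hY
        omega) (by
      rw [tot_sub, tot_single, pairJI_congr (hk.2.1.trans htt), pairJI_idx, pairJK, if_pos rfl]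
      push_cast at hN
      omega)
    refine ⟨d', ?_, ?_⟩
    · rw [sub_sub, ← single_add] at hd'
      push_cast
      rwa [add_comm (N : ℤ)]
    · rw [Function.iterate_succ_apply, Option.bind_some, hop, hit]

/-- The simple reflection acts on a pair by a string move on each component. -/
theorem iterate (h : TensorRule a1 a2 s s' mk op ν) {t t' q : ℤ} {X b Y d : ℤ →₀ ℤ}
    (hb : StringData a1 a2 s t X b) (hd : StringData a1 a2 s' t' Y d)
    (htt : idx (t' + 1) = idx (t + 1)) (hX : X (t + 1) = 0)
    (hq : ν (idx (t + 1)) - tot a1 a2 (idx (t + 1)) b + tot a1 a2 (idx (t + 1)) d = q)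
    (hYq : Y (t' + 1) ≤ q) :
    ∃ b' d', StringData a1 a2 s t (X + single (t + 1) (q - Y (t' + 1))) b' ∧
      StringData a1 a2 s' (t' + 1) (Y - single (t' + 1) (Y (t' + 1))) d' ∧
      (fun o => o.bind (op (idx (t + 1))))^[q.toNat] (some (mk b d)) = some (mk b' d') := by
  have hY := hd.nonneg (t' + 1)
  obtain ⟨N, hN⟩ := Int.eq_ofNat_of_zero_le (show 0 ≤ q - Y (t' + 1) by omega)
  obtain ⟨M, hM⟩ := Int.eq_ofNat_of_zero_le hY
  obtain ⟨b', hb', hit⟩ := h.iterate_raise hd htt N hb (by omega)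
  obtain ⟨d', hd', hit'⟩ := h.iterate_lower hb' htt M hd hM (by
    rw [← hb'.tot_eq, tot_add_single, hb.tot_eq, pairJI_idx, pairJK, if_pos rfl]
    simp only [Finsupp.add_apply, single_apply, if_true]
    omega)
  refine ⟨b', d', by rwa [hN], ?_, ?_⟩
  · rw [hM]
    refine hd'.unshift ?_
    simp [hM]
  · rw [show q.toNat = M + N by omega, Function.iterate_add_apply, hit, hit']

/-- Reflecting successively in the directions `i_s, i_{s-1}, …` moves the entries of the string
datum of one component to the other one. -/
theorem exists_reflected (h : TensorRule a1 a2 s s' mk op ν)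
    (h' : TensorRule a1 a2 s' s (fun d b => mk b d) op' fun i => -ν i)
    (hss : s + s' = -1) {q : ℤ → ℤ} (hq0 : ∀ k, 0 < q k)
    (hq : ∀ k, q (k - 1) + q (k + 1) = cart a1 a2 k * q k)
    {S : ℤ → Option (ℤ → ℤ) → Option (ℤ → ℤ)}
    (hS : ∀ {i b d}, IsI i → 0 < ν i - tot a1 a2 i b + tot a1 a2 i d →
      S i (some (mk b d)) = (fun o => o.bind (op i))^[
        (ν i - tot a1 a2 i b + tot a1 a2 i d).toNat] (some (mk b d)))
    {b0 d0 X0 Y0 : ℤ →₀ ℤ} (hb0 : StringData a1 a2 s s X0 b0)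
    (hd0 : StringData a1 a2 s' s' Y0 d0)
    (hw0 : ν (idx s) - tot a1 a2 (idx s) b0 + tot a1 a2 (idx s) d0 = q s)
    (hw1 : ν (idx (s + 1)) - tot a1 a2 (idx (s + 1)) b0 + tot a1 a2 (idx (s + 1)) d0 =
      -q (s + 1))
    (hE : ∀ js : List ℤ, (∀ j ∈ js, IsI j) → ∀ b d, js.foldr S (some (mk b0 d0)) = some (mk b d) →
      ∀ i, IsI i → 0 < ν i - tot a1 a2 i b + tot a1 a2 i d → op' i (mk b d) = none) (n : ℕ) :
    ∃ X b Y d, ∃ js : List ℤ, (∀ j ∈ js, IsI j) ∧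
      js.foldr S (some (mk b0 d0)) = some (mk b d) ∧
      StringData a1 a2 s (s - n) X b ∧
      (∀ k, s - n < k → X k = if s < k then X0 k else q k - Y0 (-k)) ∧
      StringData a1 a2 s' (s' + n) Y d ∧ (∀ k, s' + n < k → Y k = Y0 k) ∧
      ν (idx (s - n)) - tot a1 a2 (idx (s - n)) b + tot a1 a2 (idx (s - n)) d = q (s - n) ∧
      ν (idx (s - n + 1)) - tot a1 a2 (idx (s - n + 1)) b + tot a1 a2 (idx (s - n + 1)) d =
        -q (s - n + 1) := by
  induction n with
  | zero =>
    refine ⟨X0, b0, Y0, d0, [], by simp, rfl, by simpa using hb0, ?_, by simpa using hd0,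
      fun k _ => rfl, by simpa using hw0, by simpa using hw1⟩
    intro k hk
    rw [if_pos (by simpa using hk)]
  | succ n ih =>
    obtain ⟨X, b, Y, d, js, hjs, hfold, hXb, hX, hYd, hY, hw, hw'⟩ := ih
    set j := s - (n : ℤ) with hj
    have hj1 : s' + (n : ℤ) + 1 = -j := by omega
    have hqj := hq0 j
    have hnone := hE js hjs b d hfold (idx j) (idx_isI j) (by omega)
    obtain ⟨rb, hεb⟩ := exists_isEps (a1 := a1) (a2 := a2) s j b
    have hεd := hYd.isEps
    rw [hj1, idx_neg] at hεd
    obtain ⟨hr, rfl⟩ := h'.of_eq_none hYd.eq_zero_of_le' hXb.eq_zero_of_le' hεd hεb hnone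
    have hj2 : j = j - 1 + 1 := by ring
    rw [hj2] at hXb hεb
    have hXb' := hXb.shift hεb
    have hXj : X j = 0 := hXb.eq_zero_of_le _ (by omega)
    obtain ⟨b', d', hb', hd', hit⟩ := h.iterate (q := q j) hXb' hYd
      (by rw [hj1, idx_neg, ← hj2]) (by rw [← hj2]; exact hXj) (by rw [← hj2]; exact hw)
      (by rw [hj1]; omega)
    rw [hj1, ← hj2] at *
    have hw2 : ∀ i, tot a1 a2 i b' - tot a1 a2 i d' =
        tot a1 a2 i b - tot a1 a2 i d + pairJI a1 a2 j i * q j := by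
      intro i
      rw [← hb'.tot_eq, ← hd'.tot_eq, tot_add_single, tot_sub, tot_single, hXb.tot_eq, hYd.tot_eq,
        pairJI_congr (idx_neg j)]
      ring
    refine ⟨_, b', _, d', idx j :: js, ?_, ?_, by push_cast; convert hb' using 1; omega, ?_,
      by push_cast; convert hd' using 1; omega, ?_, ?_, ?_⟩
    · rintro i (_ | ⟨_, hi⟩)
      · exact idx_isI j
      · exact hjs i hi
    · rw [List.foldr_cons, hfold, hS (idx_isI j) (by omega), hw, hit]
    · intro k hk
      push_cast at hk
      rw [Finsupp.add_apply, single_apply]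
      split
      · rename_i hjk
        subst hjk
        rw [hXj, if_neg (by omega), hY (-j) (by omega)]
        ring
      · rw [add_zero, hX k (by omega)]
    · intro k hk
      push_cast at hk
      rw [Finsupp.sub_apply, single_apply, if_neg (by omega), hY k (by omega), sub_zero]
    · have e := hw2 (idx (j - 1))
      have hp : pairJI a1 a2 j (idx (j - 1)) = -cart a1 a2 j := by
        rw [pairJI_idx, pairJK_of_ne (by omega)]
      have e2 : idx (j + 1) = idx (j - 1) := by rw [idx_eq_idx]; omega
      have e3 := hq j
      rw [hp] at e
      rw [e2] at hw'
      push_cast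
      rw [show s - ((n : ℤ) + 1) = j - 1 by omega]
      linarith
    · have e := hw2 (idx j)
      rw [pairJI_idx, pairJK, if_pos rfl] at e
      push_cast
      rw [show s - ((n : ℤ) + 1) + 1 = j by omega]
      linarith

end TensorRule

theorem TensorRule.bounds {s s' : ℤ} {mk : (ℤ →₀ ℤ) → (ℤ →₀ ℤ) → ℤ → ℤ}
    {op op' : ℤ → (ℤ → ℤ) → Option (ℤ → ℤ)} {ν : ℤ → ℤ} (ha : Hyperbolic a1 a2)
    (h : TensorRule a1 a2 s s' mk op ν)
    (h' : TensorRule a1 a2 s' s (fun d b => mk b d) op' fun i => -ν i)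
    (hss : s + s' = -1) {q : ℤ → ℤ} (hq0 : ∀ k, 0 < q k)
    (hq : ∀ k, q (k - 1) + q (k + 1) = cart a1 a2 k * q k)
    {S : ℤ → Option (ℤ → ℤ) → Option (ℤ → ℤ)}
    (hS : ∀ {i b d}, IsI i → 0 < ν i - tot a1 a2 i b + tot a1 a2 i d →
      S i (some (mk b d)) = (fun o => o.bind (op i))^[
        (ν i - tot a1 a2 i b + tot a1 a2 i d).toNat] (some (mk b d)))
    {b0 d0 X0 Y0 : ℤ →₀ ℤ} (hb0 : StringData a1 a2 s s X0 b0)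
    (hd0 : StringData a1 a2 s' s' Y0 d0)
    (hw0 : ν (idx s) - tot a1 a2 (idx s) b0 + tot a1 a2 (idx s) d0 = q s)
    (hw1 : ν (idx (s + 1)) - tot a1 a2 (idx (s + 1)) b0 + tot a1 a2 (idx (s + 1)) d0 =
      -q (s + 1))
    (hE : ∀ js : List ℤ, (∀ j ∈ js, IsI j) → ∀ b d, js.foldr S (some (mk b0 d0)) = some (mk b d) →
      ∀ i, IsI i → 0 < ν i - tot a1 a2 i b + tot a1 a2 i d → op' i (mk b d) = none)
    {U : ℤ → ℤ} (hU : ∀ k, U k = if s < k then X0 k else q k - Y0 (-k)) :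
    (∀ k, 0 ≤ U k) ∧ ∀ k, (U (k + 1) : ℝ) ≤ gammaR a1 a2 k * U k := by
  have key : ∀ t ≤ s, ∃ X, Cone a1 a2 t X ∧ ∀ k, t < k → X k = U k := by
    intro t ht
    obtain ⟨X, b, Y, d, js, -, -, hX, hXU, -⟩ :=
      h.exists_reflected h' hss hq0 hq hS hb0 hd0 hw0 hw1 hE (s - t).toNat
    rw [show s - ((s - t).toNat : ℤ) = t by omega] at hX hXU
    exact ⟨X, hX.symm.cone ha, fun k hk => by rw [hXU k hk, hU]⟩
  have h0 : ∀ k, 0 ≤ U k := fun k => by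
    obtain ⟨X, hX, hXU⟩ := key (min s (k - 1)) (min_le_left _ _)
    rw [← hXU k (by omega)]
    exact hX.2.1 k
  refine ⟨h0, fun k => ha.le_gammaR_mul (t0 := s) (h0 k) fun t ht n hn => ?_⟩
  obtain ⟨X, hX, hXU⟩ := key t ht
  have := hX.2.2 n
  rw [show t + (n : ℤ) + 2 = k + 1 by omega, ← hn, hXU _ (by omega), hXU _ (by omega)] at this
  exact this

/-- Removing the first string of a string datum. -/
theorem StringData.exists_pop {s t : ℤ} {F : ℤ → (ℤ → ℤ) → ℤ → ℤ} {mk : (ℤ →₀ ℤ) → ℤ → ℤ}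
    (hF : ∀ {i z k}, ActsAt a1 a2 s i z k → F i (mk z) = mk (z + single k 1)) (N : ℕ) :
    ∀ {X m : ℤ →₀ ℤ}, StringData a1 a2 s t X m → X (t + 1) = N →
      ∃ m', StringData a1 a2 s (t + 1) (X - single (t + 1) (N : ℤ)) m' ∧
        (F (idx (t + 1)))^[N] (mk m') = mk m := by
  induction N with
  | zero =>
    intro X m h hX
    exact ⟨m, by simpa using h.unshift (by simpa using hX), rfl⟩
  | succ N ih =>
    intro X m h hX
    have hε := h.isEps
    rw [hX] at hε
    obtain ⟨k, hk⟩ := hε.exists_lowersAt (by positivity)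
    have hmk : m = (m - single k 1) + single k 1 := by simp
    have hact := hk.actsAt hmk
    obtain ⟨m', hm', hit⟩ := ih (h.pop hmk hact) (by simp [hX])
    refine ⟨m', ?_, ?_⟩
    · rw [sub_sub, ← single_add] at hm'
      push_cast
      rwa [add_comm (N : ℤ)]
    · rw [Function.iterate_succ_apply', hit, hF hact, ← hmk]

theorem starPChain_spec {Y x : ℤ →₀ ℤ} (h : StringData a1 a2 0 0 Y x) (n : ℕ) :
    ∃ X m : ℤ →₀ ℤ, StringData a1 a2 0 n X m ∧ (∀ k, (n : ℤ) < k → X k = Y k) ∧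
      starPChain a1 a2 Y n m = x := by
  induction n with
  | zero => exact ⟨Y, x, h, fun _ _ => rfl, rfl⟩
  | succ n ih =>
    obtain ⟨X, m, hm, hX, hc⟩ := ih
    obtain ⟨N, hN⟩ := Int.eq_ofNat_of_zero_le (hm.nonneg (n + 1))
    obtain ⟨m', hm', hit⟩ := hm.exists_pop (F := fP a1 a2) (mk := fun z => z) fP_coe N hN
    refine ⟨_, m', by exact_mod_cast hm', fun k hk => ?_, ?_⟩
    · push_cast at hk
      rw [Finsupp.sub_apply, single_apply, if_neg (by omega), hX k (by omega), sub_zero]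
    · rw [starPChain, fPiter, ← hX _ (by omega), hN, Int.toNat_natCast, hit, hc]

theorem starP_coe {Y x : ℤ →₀ ℤ} (h : StringData a1 a2 0 0 Y x) : starP a1 a2 Y = x := by
  have hne : {N : ℕ | ∀ k : ℤ, (N : ℤ) < k → Y k = 0}.Nonempty := by
    obtain ⟨N, hN⟩ := exists_support_bound Y
    exact ⟨N.toNat, fun k hk => hN k (by omega)⟩
  have hb : ∀ k : ℤ, (suppBoundP Y : ℤ) < k → Y k = 0 := Nat.sInf_mem hne
  obtain ⟨X, m, hm, hX, hc⟩ := starPChain_spec h (suppBoundP Y)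
  have hX0 : X = 0 := by
    ext k
    by_cases hk : (suppBoundP Y : ℤ) < k
    · rw [hX k hk, hb k hk, Finsupp.zero_apply]
    · exact hm.eq_zero_of_le k (by omega)
  rw [hm.eq_zero_right hX0] at hc
  exact hc

theorem starMChain_spec {Y x : ℤ →₀ ℤ} (h : StringData a1 a2 (-1) (-1) Y x) (n : ℕ) :
    ∃ X m : ℤ →₀ ℤ, StringData a1 a2 (-1) (n - 1) X m ∧ (∀ k, (n : ℤ) - 1 < k → X k = Y k) ∧
      starMChain a1 a2 (-reflect Y : ℤ →₀ ℤ) n (-reflect m : ℤ →₀ ℤ) =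
        (-reflect x : ℤ →₀ ℤ) := by
  induction n with
  | zero => exact ⟨Y, x, by simpa using h, fun _ _ => rfl, rfl⟩
  | succ n ih =>
    obtain ⟨X, m, hm, hX, hc⟩ := ih
    obtain ⟨N, hN⟩ := Int.eq_ofNat_of_zero_le (hm.nonneg (n - 1 + 1))
    obtain ⟨m', hm', hit⟩ := hm.exists_pop (F := eM a1 a2)
      (mk := fun z => (-reflect z : ℤ →₀ ℤ)) eM_coe N hN
    rw [sub_add_cancel] at *
    refine ⟨_, m', by convert hm' using 1; push_cast; ring, fun k hk => ?_, ?_⟩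
    · push_cast at hk
      rw [Finsupp.sub_apply, single_apply, if_neg (by omega), hX k (by omega), sub_zero]
    · have hY : (-((-reflect Y : ℤ →₀ ℤ) (-(n : ℤ)))).toNat = N := by
        rw [Finsupp.neg_apply, reflect_apply, neg_neg, neg_neg, ← hX _ (by omega), hN,
          Int.toNat_natCast]
      rw [starMChain, eMiter, hY, idx_neg, hit, hc]

theorem starM_coe {Y x : ℤ →₀ ℤ} (h : StringData a1 a2 (-1) (-1) Y x) :
    starM a1 a2 (-reflect Y : ℤ →₀ ℤ) = (-reflect x : ℤ →₀ ℤ) := by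
  have hne : {N : ℕ | ∀ k : ℤ, k < -(N : ℤ) → (-reflect Y : ℤ →₀ ℤ) k = 0}.Nonempty := by
    obtain ⟨N, hN⟩ := exists_support_bound Y
    exact ⟨N.toNat, fun k hk => by simp [hN (-k) (by omega)]⟩
  have hb : ∀ k : ℤ, k < -(suppBoundM (-reflect Y : ℤ →₀ ℤ) : ℤ) →
      (-reflect Y : ℤ →₀ ℤ) k = 0 := Nat.sInf_mem hne
  obtain ⟨X, m, hm, hX, hc⟩ := starMChain_spec h (suppBoundM (-reflect Y : ℤ →₀ ℤ) + 1)
  rw [Nat.cast_add, Nat.cast_one, add_sub_cancel_right] at hm hX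
  have hX0 : X = 0 := by
    ext k
    by_cases hk : (suppBoundM (-reflect Y : ℤ →₀ ℤ) : ℤ) < k
    · have := hb (-k) (by omega)
      rw [Finsupp.neg_apply, reflect_apply, neg_neg, neg_eq_zero] at this
      rw [hX k hk, this, Finsupp.zero_apply]
    · exact hm.eq_zero_of_le k (by omega)
  rw [hm.eq_zero_right hX0] at hc
  rw [← hc, starM]
  congr 1

theorem cgen_zero_eq (n : ℕ) : cgen a1 a2 0 n = cseq a1 a2 n := by
  induction n using Nat.twoStepInduction with
  | zero => rfl
  | one => rfl
  | more n h1 h2 =>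
    rw [cgen_succ_succ, cseq, h1, h2, cart]
    congr 2
    simp only [show (0 + (n : ℤ) + 2) % 2 = 0 ↔ n % 2 = 0 by omega]

theorem cgen_neg_one_eq (n : ℕ) : cgen a1 a2 (-1) n = cseq' a1 a2 n := by
  induction n using Nat.twoStepInduction with
  | zero => rfl
  | one => rfl
  | more n h1 h2 =>
    rw [cgen_succ_succ, cseq', h1, h2, cart]
    congr 2
    by_cases h : n % 2 = 0
    · rw [if_neg (by omega), if_pos h]
    · rw [if_pos (by omega), if_neg h]

theorem XPlusMem.exists_cone {x : ℤ → ℤ} (h : XPlusMem a1 a2 x) :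
    ∃ Y : ℤ →₀ ℤ, (Y : ℤ → ℤ) = x ∧ Cone a1 a2 0 Y := by
  obtain ⟨⟨h0, hn, N, hN⟩, hc⟩ := h
  have hfin : (Function.support x).Finite := (Set.finite_Icc (0 : ℤ) N).subset fun k hk => by
    by_contra hk'
    rw [Set.mem_Icc, not_and_or] at hk'
    rcases hk' with hk' | hk'
    · exact hk (h0 k (by omega))
    · exact hk (hN k (by omega))
  refine ⟨Finsupp.ofSupportFinite x hfin, rfl, h0, hn, fun n => ?_⟩
  have := hc (n + 1) (by omega)
  rw [show ((n : ℤ) + 1).toNat = n + 1 by omega, show ((n : ℤ) + 1 - 1).toNat = n by omega] at this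
  rw [cgen_zero_eq, cgen_zero_eq, Finsupp.ofSupportFinite_coe,
    show (0 : ℤ) + n + 2 = n + 1 + 1 by ring, zero_add]
  linarith

theorem XMinusMem.exists_cone {x : ℤ → ℤ} (h : XMinusMem a1 a2 x) :
    ∃ Y : ℤ →₀ ℤ, ((-reflect Y : ℤ →₀ ℤ) : ℤ → ℤ) = x ∧ Cone a1 a2 (-1) Y := by
  obtain ⟨⟨h0, hn, N, hN⟩, hc⟩ := h
  have hfin : (Function.support fun k => -x (-k)).Finite :=
    (Set.finite_Icc (0 : ℤ) N).subset fun k hk => by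
      by_contra hk'
      rw [Function.mem_support, neg_ne_zero] at hk
      rw [Set.mem_Icc, not_and_or] at hk'
      rcases hk' with hk' | hk'
      · exact hk (h0 _ (by omega))
      · exact hk (hN _ (by omega))
  refine ⟨Finsupp.ofSupportFinite _ hfin, ?_, fun k hk => ?_, fun k => ?_, fun n => ?_⟩
  · ext k
    simp [Finsupp.ofSupportFinite_coe]
  · rw [Finsupp.ofSupportFinite_coe, h0 _ (by omega), neg_zero]
  · rw [Finsupp.ofSupportFinite_coe]
    have := hn (-k)
    omega
  · have := hc (-n) (by omega)
    rw [show (1 - -(n : ℤ)).toNat = n + 1 by omega, show (- -(n : ℤ)).toNat = n by omega] at this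
    rw [cgen_neg_one_eq, cgen_neg_one_eq, Finsupp.ofSupportFinite_coe]
    rw [show -(-1 + (n : ℤ) + 2) = -n - 1 by ring, show -(-1 + (n : ℤ) + 1) = -n by ring]
    linarith

theorem Cone.exists_stringData_self (ha : Hyperbolic a1 a2) {s : ℤ} {Y : ℤ →₀ ℤ}
    (h : Cone a1 a2 s Y) : ∃ x, StringData a1 a2 s s Y x := by
  obtain ⟨x, hx⟩ := h.exists_stringData ha (Y.sum fun _ n => n).toNat (Int.self_le_toNat _) s
  exact ⟨x, hx.symm⟩

theorem pseq_natCast (k1 k2 : ℤ) (n : ℕ) : pseq a1 a2 k1 k2 n = ppos a1 a2 k1 k2 n := by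
  simp [pseq]

theorem pseq_neg_natCast (k1 k2 : ℤ) (n : ℕ) :
    pseq a1 a2 k1 k2 (-n) = pneg a1 a2 k1 k2 n := by
  rcases Nat.eq_zero_or_pos n with rfl | hn
  · simp [pseq, ppos, pneg]
  · rw [pseq, if_neg (by omega), neg_neg, Int.toNat_natCast]

theorem pseq_recurrence (k1 k2 k : ℤ) :
    pseq a1 a2 k1 k2 (k - 1) + pseq a1 a2 k1 k2 (k + 1) =
      cart a1 a2 k * pseq a1 a2 k1 k2 k := by
  rcases lt_trichotomy k 0 with hk | rfl | hk
  · obtain ⟨n, rfl⟩ : ∃ n : ℕ, k = -((n + 1 : ℕ) : ℤ) := ⟨(-k - 1).toNat, by omega⟩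
    rw [show -((n + 1 : ℕ) : ℤ) - 1 = -((n + 2 : ℕ) : ℤ) by push_cast; ring,
      show -((n + 1 : ℕ) : ℤ) + 1 = -(n : ℤ) by push_cast; ring,
      pseq_neg_natCast, pseq_neg_natCast, pseq_neg_natCast, pneg, cart]
    by_cases h : n % 2 = 0
    · rw [if_pos (by omega), if_neg (by omega)]; ring
    · rw [if_neg (by omega), if_pos (by omega)]; ring
  · simp [pseq, cart, ppos, pneg]
  · obtain ⟨n, rfl⟩ : ∃ n : ℕ, k = ((n + 1 : ℕ) : ℤ) := ⟨(k - 1).toNat, by omega⟩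
    rw [show ((n + 1 : ℕ) : ℤ) - 1 = (n : ℤ) by push_cast; ring,
      show ((n + 1 : ℕ) : ℤ) + 1 = ((n + 2 : ℕ) : ℤ) by push_cast; ring,
      pseq_natCast, pseq_natCast, pseq_natCast, ppos, cart]
    by_cases h : n % 2 = 0
    · rw [if_pos (by omega), if_neg (by omega)]; ring
    · rw [if_neg (by omega), if_pos (by omega)]; ring

theorem cart_neg (k : ℤ) : cart a1 a2 (-k) = cart a1 a2 k := by
  simp only [cart, show (-k) % 2 = 0 ↔ k % 2 = 0 by omega]

section Positivity

variable {q : ℤ → ℤ}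

theorem recurrence_reflect (hq : ∀ k, q (k - 1) + q (k + 1) = cart a1 a2 k * q k) (k : ℤ) :
    q (-(k - 1)) + q (-(k + 1)) = cart a1 a2 k * q (-k) := by
  have := hq (-k)
  rw [cart_neg] at this
  rw [← this, show -(k - 1) = -k + 1 by ring, show -(k + 1) = -k - 1 by ring, add_comm]

theorem pos_of_le_succ (hq : ∀ k, q (k - 1) + q (k + 1) = cart a1 a2 k * q k)
    (h1 : 2 ≤ a1) (h2 : 2 ≤ a2) {m : ℤ} (hm : 0 < q m)
    (hle : q m ≤ q (m + 1)) (n : ℕ) : 0 < q (m + n) ∧ q (m + n) ≤ q (m + n + 1) := by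
  induction n with
  | zero => simpa using ⟨hm, hle⟩
  | succ n ih =>
    have h := hq (m + n + 1)
    have hc : 2 ≤ cart a1 a2 (m + n + 1) := by unfold cart; split <;> assumption
    rw [add_sub_cancel_right] at h
    push_cast
    rw [← add_assoc]
    exact ⟨by omega, by nlinarith⟩

theorem pos_of_le_two_mul (hq : ∀ k, q (k - 1) + q (k + 1) = cart a1 a2 k * q k)
    {m : ℤ} (h1 : cart a1 a2 m = 1) (h2 : 4 ≤ cart a1 a2 (m + 1))
    (hm : 0 < q m) (hle : q m ≤ 2 * q (m + 1)) (n : ℕ) :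
    0 < q (m + 2 * n) ∧ q (m + 2 * n) ≤ 2 * q (m + 2 * n + 1) := by
  induction n with
  | zero => simpa using ⟨hm, hle⟩
  | succ n ih =>
    have e1 := hq (m + 2 * n + 1)
    have e2 := hq (m + 2 * n + 2)
    have hc1 : cart a1 a2 (m + 2 * n + 1) = cart a1 a2 (m + 1) := by
      simp only [cart, show (m + 2 * n + 1) % 2 = 0 ↔ (m + 1) % 2 = 0 by omega]
    have hc2 : cart a1 a2 (m + 2 * n + 2) = cart a1 a2 m := by
      simp only [cart, show (m + 2 * n + 2) % 2 = 0 ↔ m % 2 = 0 by omega]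
    rw [hc1, add_sub_cancel_right, add_assoc _ (1 : ℤ) 1] at e1
    rw [hc2, h1, show m + 2 * (n : ℤ) + 2 - 1 = m + 2 * n + 1 by ring] at e2
    push_cast
    rw [show m + 2 * ((n : ℤ) + 1) = m + 2 * n + 2 by ring]
    norm_num at e1
    have : 4 * q (m + 2 * n + 1) ≤ cart a1 a2 (m + 1) * q (m + 2 * n + 1) := by
      apply mul_le_mul_of_nonneg_right h2; omega
    constructor <;> omega

theorem pos_all_of_le_two_mul (hq : ∀ k, q (k - 1) + q (k + 1) = cart a1 a2 k * q k)
    {m : ℤ} (h1 : cart a1 a2 m = 1) (h2 : 4 ≤ cart a1 a2 (m + 1))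
    (hm : 0 < q m) (hle : q m ≤ 2 * q (m + 1)) {k : ℤ} (hk : m ≤ k) : 0 < q k := by
  have := pos_of_le_two_mul hq h1 h2 hm hle ((k - m) / 2).toNat
  rcases Int.emod_two_eq_zero_or_one (k - m) with h | h
  · rw [show k = m + 2 * (((k - m) / 2).toNat : ℤ) by omega]
    exact this.1
  · rw [show k = m + 2 * (((k - m) / 2).toNat : ℤ) + 1 by omega]
    omega

theorem pos_all_of_le_succ (hq : ∀ k, q (k - 1) + q (k + 1) = cart a1 a2 k * q k)
    (h1 : 2 ≤ a1) (h2 : 2 ≤ a2) {m : ℤ} (hm : 0 < q m)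
    (hle : q m ≤ q (m + 1)) {k : ℤ} (hk : m ≤ k) : 0 < q k := by
  have := pos_of_le_succ hq h1 h2 hm hle (k - m).toNat
  rw [show m + ((k - m).toNat : ℤ) = k by omega] at this
  exact this.1

theorem recurrence_pos (hq : ∀ k, q (k - 1) + q (k + 1) = cart a1 a2 k * q k)
    (ha : Hyperbolic a1 a2) (h0 : 0 < q 0) (h1 : 0 < q 1)
    (hreg : 2 ≤ a1 → 2 ≤ a2 →
      (q 0 ≤ q 1 ∧ q 1 < (a1 - 1) * q 0) ∨ (q 1 < q 0 ∧ q 0 ≤ (a2 - 1) * q 1))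
    (hdeg1 : a1 = 1 → 2 * q 1 ≤ q 0 ∧ q 0 ≤ (a2 - 2) * q 1)
    (hdeg2 : a2 = 1 → 2 * q 0 ≤ q 1 ∧ q 1 ≤ (a1 - 2) * q 0) (k : ℤ) : 0 < q k := by
  obtain ⟨ha1, ha2, ha⟩ := ha
  have hr := recurrence_reflect hq
  have em1 : q (-1) + q 1 = a1 * q 0 := by simpa [cart] using hq 0
  have e2 : q 0 + q 2 = a2 * q 1 := by simpa [cart] using hq 1
  have e3 : q 1 + q 3 = a1 * q 2 := by simpa [cart] using hq 2
  have em2 : q (-2) + q 0 = a2 * q (-1) := by simpa [cart] using hq (-1)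
  suffices H : (∀ k, 2 ≤ k → 0 < q k) ∧ ∀ k, 1 ≤ k → 0 < q (-k) by
    rcases lt_trichotomy k 0 with hk | rfl | hk
    · simpa using H.2 (-k) (by omega)
    · exact h0
    · rcases eq_or_ne k 1 with rfl | hk1
      · exact h1
      · exact H.1 k (by omega)
  by_cases hc1 : a1 = 1
  · obtain ⟨hl, hu⟩ := hdeg1 hc1
    subst hc1
    have hA : 4 ≤ a2 := by omega
    constructor
    · intro k hk
      refine pos_all_of_le_two_mul hq (m := 2) (by simp [cart]) (by simpa [cart]) ?_ ?_ hk
      · nlinarith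
      · norm_num; nlinarith
    · intro k hk
      refine pos_all_of_le_two_mul (q := fun k => q (-k)) hr (m := 0) (by simp [cart])
        (by simpa [cart]) (by simpa) ?_ (by omega)
      norm_num; omega
  by_cases hc2 : a2 = 1
  · obtain ⟨hl, hu⟩ := hdeg2 hc2
    subst hc2
    have hA : 4 ≤ a1 := by omega
    constructor
    · intro k hk
      refine pos_all_of_le_two_mul hq (m := 1) (by simp [cart]) (by simpa [cart]) h1 ?_ (by omega)
      norm_num; omega
    · intro k hk
      refine pos_all_of_le_two_mul (q := fun k => q (-k)) hr (m := 1) (by simp [cart])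
        (by simpa [cart]) ?_ ?_ hk
      · nlinarith
      · norm_num; nlinarith
  have hA1 : 2 ≤ a1 := by omega
  have hA2 : 2 ≤ a2 := by omega
  rcases hreg hA1 hA2 with ⟨hl, hu⟩ | ⟨hl, hu⟩
  · constructor
    · intro k hk
      exact pos_all_of_le_succ hq hA1 hA2 (m := 0) h0 (by simpa) (by omega)
    · intro k hk
      refine pos_all_of_le_succ (q := fun k => q (-k)) hr hA1 hA2 (m := 0) (by simpa) ?_
        (by omega)
      norm_num; nlinarith
  · constructor
    · intro k hk
      refine pos_all_of_le_succ hq hA1 hA2 (m := 1) h1 ?_ (by omega)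
      norm_num; nlinarith
    · intro k hk
      refine pos_all_of_le_succ (q := fun k => q (-k)) hr hA1 hA2 (m := -1) (by simpa) ?_
        (by omega)
      norm_num; exact hl.le

end Positivity

theorem SiO_pr_of_pos {μ : ℤ × ℤ} {b d : ℤ →₀ ℤ} {i : ℤ} (hi : IsI i)
    (h : 0 < pairW μ i - tot a1 a2 i b + tot a1 a2 i d) :
    SiO a1 a2 μ i (some (pr b d : ℤ → ℤ)) = (fun o : Option (ℤ → ℤ) => o.bind (fZ a1 a2 μ i))^[
      (pairW μ i - tot a1 a2 i b + tot a1 a2 i d).toNat] (some (pr b d : ℤ → ℤ)) := by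
  rw [SiO, Option.bind_some, pairW_wtZ_pr μ b d hi, if_pos h.le, fZiterO]

theorem SiO_pr_of_neg {μ : ℤ × ℤ} {b d : ℤ →₀ ℤ} {i : ℤ} (hi : IsI i)
    (h : 0 < -pairW μ i - tot a1 a2 i d + tot a1 a2 i b) :
    SiO a1 a2 μ i (some (pr b d : ℤ → ℤ)) = (fun o : Option (ℤ → ℤ) => o.bind (eZ a1 a2 μ i))^[
      (-pairW μ i - tot a1 a2 i d + tot a1 a2 i b).toNat] (some (pr b d : ℤ → ℤ)) := by
  rw [SiO, Option.bind_some, pairW_wtZ_pr μ b d hi, if_neg (by omega), eZiterO]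
  congr 2
  ring

theorem Extremal.of_foldr {μ : ℤ × ℤ} {x b' : ℤ → ℤ} (h : Extremal a1 a2 μ x) {js : List ℤ}
    (hjs : ∀ j ∈ js, IsI j) (hb : js.foldr (SiO a1 a2 μ) (some x) = some b') {i : ℤ} (hi : IsI i) :
    (0 ≤ pairW (wtZ a1 a2 μ b') i → eZ a1 a2 μ i b' = none) ∧
      (pairW (wtZ a1 a2 μ b') i ≤ 0 → fZ a1 a2 μ i b' = none) := by
  obtain ⟨c, hc, H⟩ := h js hjs
  obtain rfl : b' = c := Option.some_injective _ (hb.symm.trans hc)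
  exact H i hi

theorem gammaR_congr {k l : ℤ} (h : k % 2 = l % 2) : gammaR a1 a2 k = gammaR a1 a2 l := by
  rw [gammaR, gammaR, h]

/-- The coordinates of `x ∈ Z_ι(λ)`, shifted by `p_k` at the positions `k ≤ 0`. -/
def shifted (p x : ℤ → ℤ) (k : ℤ) : ℤ := if 1 ≤ k then x k else x k + p k

variable (a1 a2) in
/-- The inequalities defining `Σ_ι[λ]`, in terms of the shifted coordinates. -/
structure Bounded (p u : ℤ → ℤ) : Prop where
  nonneg : ∀ k, 0 ≤ u k
  le : ∀ k, u k ≤ p k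
  le_mul : ∀ k, (u (k + 1) : ℝ) ≤ gammaR a1 a2 k * u k
  sub_le_mul : ∀ k, (p k - u k : ℝ) ≤ gammaR a1 a2 (k + 1) * (p (k + 1) - u (k + 1))

theorem xstarFun_eq {y : ℤ → ℤ} {Y D b d : ℤ →₀ ℤ} (hY : (Y : ℤ → ℤ) = posPart y)
    (hD : ((-reflect D : ℤ →₀ ℤ) : ℤ → ℤ) = negPart y) (hb : StringData a1 a2 0 0 Y b)
    (hd : StringData a1 a2 (-1) (-1) D d) : xstarFun a1 a2 y = pr b d := by
  rw [xstarFun, ← hY, ← hD, starP_coe hb, starM_coe hd]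
  ext k
  by_cases hk : 1 ≤ k
  · simp [combine, hk, pr, hd.eq_zero_of_le' (-k) (by omega)]
  · simp [combine, hk, pr, hb.eq_zero_of_le' k (by omega)]

theorem pairW_mustar {y : ℤ → ℤ} {Y D b d : ℤ →₀ ℤ} (hY : (Y : ℤ → ℤ) = posPart y)
    (hD : ((-reflect D : ℤ →₀ ℤ) : ℤ → ℤ) = negPart y) (hb : StringData a1 a2 0 0 Y b)
    (hd : StringData a1 a2 (-1) (-1) D d) (lam : ℤ × ℤ) {i : ℤ} (hi : IsI i) :
    pairW (mustar a1 a2 lam y) i - tot a1 a2 i b + tot a1 a2 i d = -pairW lam i := by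
  have h1 := pairW_wtOf_coe (a1 := a1) (a2 := a2) Y hi
  have h2 := pairW_wtOf_coe (a1 := a1) (a2 := a2) (-reflect D) hi
  rw [← zero_sub, tot_sub, tot_zero, tot_reflect, zero_sub, hD, hd.tot_eq] at h2
  rw [hY, hb.tot_eq] at h1
  have h3 : pairW (mustar a1 a2 lam y) i = -pairW lam i - pairW (wtOf a1 a2 (posPart y)) i -
      pairW (wtOf a1 a2 (negPart y)) i := by
    unfold mustar pairW
    split <;> simp
  rw [h3, h1, h2]
  ring

theorem Extremal.bounded (ha : Hyperbolic a1 a2) {p y : ℤ → ℤ} (hp0 : ∀ k, 0 < p k)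
    (hp : ∀ k, p (k - 1) + p (k + 1) = cart a1 a2 k * p k) (hy : XXMem a1 a2 y)
    (hext : Extremal a1 a2 (mustar a1 a2 (lamW (p 1) (p 0)) y) (xstarFun a1 a2 y)) :
    Bounded a1 a2 p (shifted p y) := by
  obtain ⟨Y, hY, hYc⟩ := hy.1.exists_cone
  obtain ⟨D, hD, hDc⟩ := hy.2.exists_cone
  obtain ⟨b, hb⟩ := hYc.exists_stringData_self ha
  obtain ⟨d, hd⟩ := hDc.exists_stringData_self ha
  have hW := fun {i} => pairW_mustar hY hD hb hd (lamW (p 1) (p 0)) (i := i)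
  rw [xstarFun_eq hY hD hb hd] at hext
  generalize mustar a1 a2 (lamW (p 1) (p 0)) y = μ at hext hW
  have hW1 : pairW μ 1 - tot a1 a2 1 b + tot a1 a2 1 d = -p 1 := hW (Or.inl rfl)
  have hW2 : pairW μ 2 - tot a1 a2 2 b + tot a1 a2 2 d = p 0 := by
    simpa [pairW, lamW] using hW (Or.inr rfl)
  have hYk : ∀ k, Y k = if 1 ≤ k then y k else 0 := congr_fun hY
  have hDk : ∀ k, -D (-k) = if k ≤ 0 then y k else 0 := congr_fun hD
  have hf := (tensorRule_fZ μ).bounds ha (tensorRule_eZ μ) (by norm_num) hp0 hp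
    (S := SiO a1 a2 μ) (fun hi h => SiO_pr_of_pos hi h) hb hd hW2 hW1
    (fun js hjs b' d' hbd i hi h => (hext.of_foldr hjs hbd hi).1
      (by rw [pairW_wtZ_pr μ b' d' hi]; exact h.le)) (U := shifted p y) (fun k => by
      have h1 := hYk k
      have h2 := hDk k
      unfold shifted
      split_ifs at * <;> omega)
  have hneg : TensorRule a1 a2 0 (-1) (fun b d => pr b d) (fZ a1 a2 μ) fun i => - -pairW μ i := by
    simpa only [neg_neg] using tensorRule_fZ μ
  have he := (tensorRule_eZ μ).bounds ha hneg (by norm_num) (q := fun k => p (-k))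
    (fun k => hp0 _) (recurrence_reflect hp)
    (S := SiO a1 a2 μ) (fun hi h => SiO_pr_of_neg hi h) hd hb
    (by change -pairW μ 1 - tot a1 a2 1 d + tot a1 a2 1 b = p 1; omega)
    (by change -pairW μ 2 - tot a1 a2 2 d + tot a1 a2 2 b = -p 0; omega)
    (fun js hjs d' b' hbd i hi h => (hext.of_foldr hjs hbd hi).2
      (by rw [pairW_wtZ_pr μ b' d' hi]; omega)) (U := fun k => p (-k) - shifted p y (-k))
    (fun k => by
      have h1 := hYk (-k)
      have h2 := hDk (-k)
      rw [neg_neg] at h2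
      unfold shifted
      split_ifs at * <;> omega)
  refine ⟨hf.1, fun k => ?_, hf.2, fun k => ?_⟩
  · have := he.1 (-k)
    rw [neg_neg] at this
    omega
  · have := he.2 (-k - 1)
    rw [sub_add_cancel, neg_neg, neg_sub, sub_neg_eq_add, add_comm 1 k,
      gammaR_congr (show (-k - 1) % 2 = (k + 1) % 2 by omega)] at this
    exact_mod_cast this

/-- Raising one coordinate preserves the inequalities when the defining alternating sum is
negative. -/
theorem Bounded.raise (ha : Hyperbolic a1 a2) {p u v : ℤ → ℤ} {k : ℤ} (h : Bounded a1 a2 p u)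
    (hp : p k + p (k + 2) = cart a1 a2 (k + 1) * p (k + 1))
    (hk : u k - cart a1 a2 (k + 1) * u (k + 1) + u (k + 2) < 0)
    (hv : ∀ l, v l = if l = k + 2 then u l + 1 else u l) : Bounded a1 a2 p v := by
  have hp' : (p k + p (k + 2) : ℝ) = cart a1 a2 (k + 1) * p (k + 1) := by exact_mod_cast hp
  have hk' : (u k - cart a1 a2 (k + 1) * u (k + 1) + u (k + 2) + 1 : ℝ) ≤ 0 := by exact_mod_cast hk
  have hg := ha.gammaR_mul_sub k
  have hpos := ha.gammaR_pos k
  have hpos1 := ha.gammaR_pos (k + 1)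
  have hc : 0 < (cart a1 a2 (k + 1) : ℝ) - gammaR a1 a2 (k + 1) := by
    by_contra hn
    nlinarith
  have hle : ((u (k + 2) : ℝ) + 1) ≤ gammaR a1 a2 (k + 1) * u (k + 1) := by
    have h1 : (cart a1 a2 (k + 1) - gammaR a1 a2 (k + 1)) * u (k + 1) ≤
        (cart a1 a2 (k + 1) - gammaR a1 a2 (k + 1)) * (gammaR a1 a2 k * u k) :=
      mul_le_mul_of_nonneg_left (h.le_mul k) hc.le
    have h2 : (cart a1 a2 (k + 1) - gammaR a1 a2 (k + 1)) * (gammaR a1 a2 k * u k) = u k := by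
      linear_combination (u k : ℝ) * hg
    linarith
  have hge : (cart a1 a2 (k + 1) - gammaR a1 a2 (k + 1)) * (p (k + 1) - u (k + 1)) ≤
      (p (k + 2) - u (k + 2) - 1 : ℝ) := by
    have := h.sub_le_mul k
    linarith
  have hw : (0 : ℝ) ≤ p (k + 1) - u (k + 1) := by
    have := h.le (k + 1)
    rw [sub_nonneg]
    exact_mod_cast this
  refine ⟨fun l => ?_, fun l => ?_, fun l => ?_, fun l => ?_⟩
  · have := h.nonneg l
    rw [hv]
    split <;> omega
  · rw [hv]
    split_ifs with hl
    · subst hl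
      have : (0 : ℝ) ≤ p (k + 2) - u (k + 2) - 1 := (mul_nonneg hc.le hw).trans hge
      have h3 : ((u (k + 2) + 1 : ℤ) : ℝ) ≤ p (k + 2) := by push_cast; linarith
      exact_mod_cast h3
    · exact h.le l
  · rw [hv, hv]
    have h1 := h.le_mul l
    have h2 := ha.gammaR_pos l
    split_ifs with hl hl' hl'
    · omega
    · obtain rfl : l = k + 1 := by omega
      rw [show k + 1 + 1 = k + 2 by ring]
      push_cast
      exact hle
    · push_cast
      linarith
    · exact h1
  · rw [hv, hv]
    have h1 := h.sub_le_mul l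
    have h2 := ha.gammaR_pos (l + 1)
    split_ifs with hl hl' hl'
    · omega
    · push_cast
      linarith
    · obtain rfl : l = k + 1 := by omega
      rw [show k + 1 + 1 = k + 2 by ring, gammaR_add_two]
      push_cast
      calc (p (k + 1) - u (k + 1) : ℝ) = gammaR a1 a2 k *
            ((cart a1 a2 (k + 1) - gammaR a1 a2 (k + 1)) * (p (k + 1) - u (k + 1))) := by
            linear_combination -(p (k + 1) - u (k + 1) : ℝ) * hg
        _ ≤ gammaR a1 a2 k * (p (k + 2) - (u (k + 2) + 1)) := by
            apply mul_le_mul_of_nonneg_left _ hpos.le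
            linarith
    · exact h1

variable (a1 a2) in
/-- `σ_k(x) + ⟨wt(x), α_{i_k}^∨⟩` on `Z_ι(μ)`. -/
noncomputable def tau (μ : ℤ × ℤ) (k : ℤ) (z : ℤ →₀ ℤ) : ℤ :=
  sg a1 a2 k z - tot a1 a2 (idx k) z + if 1 ≤ k then pairW μ (idx k) else 0

theorem sigmaZ_add_pairW (μ : ℤ × ℤ) (k : ℤ) (z : ℤ →₀ ℤ) :
    sigmaZ a1 a2 μ z k + pairW (wtZ a1 a2 μ z) (idx k) = tau a1 a2 μ k z := by
  rw [sigmaZ_coe, pairW_wtZ_coe μ z (idx_isI k), tau]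
  split <;> ring

theorem tau_of_forall_lt (μ : ℤ × ℤ) {k : ℤ} {z : ℤ →₀ ℤ} (hk : k ≤ 0)
    (h : ∀ j < k, z j = 0) : tau a1 a2 μ k z = -z k := by
  have := sg_add_apply (a1 := a1) (a2 := a2) h
  rw [tau, if_neg (by omega)]
  linarith

theorem tau_sub_tau_add_two {p : ℤ → ℤ} (hp : ∀ k, p (k - 1) + p (k + 1) = cart a1 a2 k * p k)
    (k : ℤ) (z : ℤ →₀ ℤ) :
    tau a1 a2 (lamW (p 1) (p 0)) k z - tau a1 a2 (lamW (p 1) (p 0)) (k + 2) z =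
      shifted p z k - cart a1 a2 (k + 1) * shifted p z (k + 1) + shifted p z (k + 2) := by
  have h1 := sg_sub_sg_add_two (a1 := a1) (a2 := a2) k z
  have h2 := hp (k + 1)
  rw [add_sub_cancel_right, show k + 1 + 1 = k + 2 by ring] at h2
  unfold tau shifted
  rw [idx_add_two]
  by_cases hk : 1 ≤ k
  · simp only [hk, show 1 ≤ k + 1 by omega, show 1 ≤ k + 2 by omega, if_true]
    linarith
  by_cases hk0 : k = 0
  · subst hk0
    simp [idx, pairW, lamW] at *
    linarith
  by_cases hk1 : k = -1
  · subst hk1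
    simp [idx, pairW, lamW] at *
    linarith
  · simp only [hk, show ¬ 1 ≤ k + 1 by omega, show ¬ 1 ≤ k + 2 by omega, if_false]
    linarith

theorem tau_add_single (μ : ℤ × ℤ) {k l : ℤ} (h : idx l = idx k) (z : ℤ →₀ ℤ) :
    tau a1 a2 μ l (z + single k 1) =
      tau a1 a2 μ l z - if l < k then 0 else if l = k then 1 else 2 := by
  have ht : tot a1 a2 (idx l) (z + single k 1) = tot a1 a2 (idx l) z + 2 := by
    rw [tot_add_single, pairJI, if_pos h.symm, mul_one]
  unfold tau
  rw [ht]
  rcases lt_trichotomy l k with hl | rfl | hl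
  · rw [sg_add_right hl h.symm, if_pos hl]
    ring
  · rw [sg_add_self, if_neg (lt_irrefl _), if_pos rfl]
    ring
  · rw [sg_add_left hl, if_neg hl.not_gt, if_neg hl.ne']
    ring

theorem exists_tau_le (μ : ℤ × ℤ) (z : ℤ →₀ ℤ) (i : ℤ) :
    ∃ B, ∀ l, idx l = i → tau a1 a2 μ l z ≤ B := by
  obtain ⟨N, hN⟩ := exists_support_bound z
  obtain ⟨N', hN'⟩ := exists_support_bound (reflect z)
  obtain ⟨B, hB⟩ := ((Finset.Icc (min 0 (-N')) N).image fun l => tau a1 a2 μ l z).bddAbove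
  refine ⟨max (max B 0) (-tot a1 a2 i z + |pairW μ i|), ?_⟩
  rintro l rfl
  by_cases h1 : l ≤ N
  · by_cases h2 : min 0 (-N') ≤ l
    · exact le_max_of_le_left (le_max_of_le_left (hB (by
        simp only [Finset.coe_image, Set.mem_image, Finset.coe_Icc, Set.mem_Icc]
        exact ⟨l, ⟨h2, h1⟩, rfl⟩)))
    · have hz : ∀ j ≤ l, z j = 0 := fun j hj => by
        have := hN' (-j) (by omega)
        rwa [reflect_apply, neg_neg] at this
      refine le_max_of_le_left (le_max_of_le_right ?_)
      rw [tau_of_forall_lt μ (by omega) fun j hj => hz j hj.le, hz l le_rfl, neg_zero]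
  · refine le_max_of_le_right ?_
    rw [tau, sg_eq_zero_of_large fun j hj => hN j (by omega)]
    have := le_abs_self (pairW μ (idx l))
    have := abs_nonneg (pairW μ (idx l))
    split <;> linarith

theorem exists_fZ_eq_some (μ : ℤ × ℤ) {z : ℤ →₀ ℤ} {l0 : ℤ} (h : 0 < tau a1 a2 μ l0 z) :
    ∃ k, idx k = idx l0 ∧ (∀ l, idx l = idx l0 → tau a1 a2 μ l z ≤ tau a1 a2 μ k z) ∧
      (∀ l < k, idx l = idx l0 → tau a1 a2 μ l z < tau a1 a2 μ k z) ∧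
      fZ a1 a2 μ (idx l0) z = some ((z + single k 1 : ℤ →₀ ℤ) : ℤ → ℤ) := by
  obtain ⟨B, hB⟩ := exists_tau_le (a1 := a1) (a2 := a2) μ z (idx l0)
  obtain ⟨e, ⟨l1, hl1, rfl⟩, hmax⟩ := Int.exists_greatest_of_bdd
    (P := fun e => ∃ l, idx l = idx l0 ∧ tau a1 a2 μ l z = e)
    ⟨B, by rintro _ ⟨l, hl, rfl⟩; exact hB l hl⟩ ⟨_, l0, rfl, rfl⟩
  have h1 : 0 < tau a1 a2 μ l1 z := h.trans_le (hmax _ ⟨l0, rfl, rfl⟩)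
  obtain ⟨N, hN⟩ := exists_support_bound (reflect z)
  obtain ⟨k, ⟨hk, hke⟩, hmin⟩ := Int.exists_least_of_bdd
    (P := fun l => idx l = idx l0 ∧ tau a1 a2 μ l z = tau a1 a2 μ l1 z)
    ⟨min 0 (-N), fun l hl => by
      by_contra hlN
      have hz : ∀ j ≤ l, z j = 0 := fun j hj => by
        have := hN (-j) (by omega)
        rwa [reflect_apply, neg_neg] at this
      rw [tau_of_forall_lt μ (by omega) fun j hj => hz j hj.le, hz l le_rfl] at hl
      omega⟩ ⟨l1, hl1, rfl⟩
  rw [← hke] at hmax h1 hmin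
  have hmin' : ∀ l < k, idx l = idx l0 → tau a1 a2 μ l z < tau a1 a2 μ k z := fun l hl hli =>
    lt_of_le_of_ne (hmax _ ⟨l, hli, rfl⟩) fun he => absurd (hmin l ⟨hli, he⟩) hl.not_ge
  refine ⟨k, hk, fun l hl => hmax _ ⟨l, hl, rfl⟩, hmin', ?_⟩
  have hσ : ∀ l, idx l = idx k → sigmaZ a1 a2 μ z l =
      tau a1 a2 μ l z - pairW (wtZ a1 a2 μ z) (idx k) := fun l hl => by
    rw [← sigmaZ_add_pairW, hl, add_sub_cancel_right]
  rw [← hk, ← update_coe]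
  refine fZ_eq_some (fun l hl => ?_) (fun l hlk hl => ?_) ?_
  · rw [hσ l hl, hσ k rfl]
    have := hmax _ ⟨l, hl.trans hk, rfl⟩
    omega
  · rw [hσ l hl, hσ k rfl]
    have := hmin' l hlk (hl.trans hk)
    omega
  · rwa [sigmaZ_add_pairW]

variable (a1 a2) in
/-- Some composite of the operators `f̃_i` maps `x` to an element satisfying `P`. -/
def Reaches (μ : ℤ × ℤ) (P : (ℤ → ℤ) → Prop) (x : ℤ → ℤ) : Prop :=
  ∃ js : List ℤ, (∀ j ∈ js, IsI j) ∧ ∃ z : ℤ → ℤ,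
    js.foldl (fun ob j => ob.bind (fZ a1 a2 μ j)) (some x) = some z ∧ P z

theorem Reaches.refl {μ : ℤ × ℤ} {P : (ℤ → ℤ) → Prop} {x : ℤ → ℤ} (h : P x) :
    Reaches a1 a2 μ P x :=
  ⟨[], by simp, x, rfl, h⟩

theorem Reaches.step {μ : ℤ × ℤ} {P : (ℤ → ℤ) → Prop} {x y : ℤ → ℤ} {i : ℤ} (hi : IsI i)
    (hx : fZ a1 a2 μ i x = some y) (h : Reaches a1 a2 μ P y) : Reaches a1 a2 μ P x := by
  obtain ⟨js, hjs, z, hz, hP⟩ := h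
  exact ⟨i :: js, by simpa using ⟨hi, hjs⟩, z, by simpa [hx] using hz, hP⟩

/-- The sum of `-z_j` over `j ≤ 0`. -/
noncomputable def depth (z : ℤ →₀ ℤ) : ℤ := z.sum fun j c => if j ≤ 0 then -c else 0

theorem depth_add_single (z : ℤ →₀ ℤ) (k : ℤ) :
    depth (z + single k 1) = depth z - if k ≤ 0 then 1 else 0 := by
  unfold depth
  rw [Finsupp.sum_add_index' (by simp) (by intros; split <;> ring),
    Finsupp.sum_single_index (by simp)]
  split <;> ring

theorem shifted_add_single (p : ℤ → ℤ) (z : ℤ →₀ ℤ) (k l : ℤ) :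
    shifted p (z + single k 1 : ℤ →₀ ℤ) l =
      if l = k then shifted p z l + 1 else shifted p z l := by
  unfold shifted
  rw [Finsupp.add_apply, single_apply]
  split_ifs <;> omega

theorem Bounded.nonpos {p : ℤ → ℤ} {z : ℤ →₀ ℤ} (h : Bounded a1 a2 p (shifted p z)) {k : ℤ}
    (hk : k ≤ 0) : z k ≤ 0 := by
  have := h.le k
  rw [shifted, if_neg (by omega)] at this
  omega

theorem Bounded.depth_nonneg {p : ℤ → ℤ} {z : ℤ →₀ ℤ} (h : Bounded a1 a2 p (shifted p z)) :
    0 ≤ depth z := by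
  refine Finset.sum_nonneg fun j _ => ?_
  dsimp only
  split_ifs with hj
  · have := h.nonpos hj
    omega
  · exact le_rfl

/-- Repeated application of the `f̃_i` moves any bounded element to one without negative part. -/
theorem Bounded.reaches (ha : Hyperbolic a1 a2) {p : ℤ → ℤ}
    (hp : ∀ k, p (k - 1) + p (k + 1) = cart a1 a2 k * p k) (n : ℕ) :
    ∀ z : ℤ →₀ ℤ, Bounded a1 a2 p (shifted p z) → depth z < n →
      Reaches a1 a2 (lamW (p 1) (p 0)) (fun x => ∃ z : ℤ →₀ ℤ, x = z ∧
        Bounded a1 a2 p (shifted p z) ∧ ∀ k ≤ 0, z k = 0) z := by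
  induction n with
  | zero =>
    intro z hz hn
    have := hz.depth_nonneg
    simp only [Nat.cast_zero] at hn
    omega
  | succ n ih =>
    have key : ∀ M : ℕ, ∀ z : ℤ →₀ ℤ, Bounded a1 a2 p (shifted p z) → depth z < n + 1 →
        ∀ k0 ≤ 0, z k0 < 0 → (∀ j < k0, z j = 0) →
        (∀ l, idx l = idx k0 → tau a1 a2 (lamW (p 1) (p 0)) l z ≤ M) →
        Reaches a1 a2 (lamW (p 1) (p 0)) (fun x => ∃ z : ℤ →₀ ℤ, x = z ∧
          Bounded a1 a2 p (shifted p z) ∧ ∀ k ≤ 0, z k = 0) z := by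
      intro M
      induction M with
      | zero =>
        intro z hz hn k0 hk0 hneg hlow hM
        have := hM k0 rfl
        rw [tau_of_forall_lt _ hk0 hlow, Nat.cast_zero] at this
        omega
      | succ M ihM =>
        intro z hz hn k0 hk0 hneg hlow hM
        obtain ⟨k, hk, hmax, hmin, hf⟩ := exists_fZ_eq_some (a1 := a1) (a2 := a2)
          (lamW (p 1) (p 0)) (z := z) (l0 := k0)
          (by rw [tau_of_forall_lt _ hk0 hlow]; omega)
        have hlt := hmin (k - 2) (by omega) (by rw [← hk, idx_eq_idx]; omega)
        have hdiff := tau_sub_tau_add_two hp (k - 2) z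
        rw [sub_add_cancel] at hdiff
        have hrec := hp (k - 2 + 1)
        rw [add_sub_cancel_right, add_assoc _ (1 : ℤ) 1] at hrec
        have hz' : Bounded a1 a2 p (shifted p (z + single k 1 : ℤ →₀ ℤ)) :=
          hz.raise ha (k := k - 2) hrec (by rw [sub_add_cancel]; omega)
            (fun l => by rw [shifted_add_single, sub_add_cancel])
        refine Reaches.step (idx_isI k0) hf ?_
        by_cases hk1 : k ≤ 0
        · refine ih _ hz' ?_
          rw [depth_add_single, if_pos hk1]
          omega
        · have happ : ∀ j ≤ 0, (z + single k 1 : ℤ →₀ ℤ) j = z j := fun j hj => by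
            rw [Finsupp.add_apply, single_apply, if_neg (by omega), add_zero]
          refine ihM _ hz' ?_ k0 hk0 ?_ ?_ ?_
          · rwa [depth_add_single, if_neg hk1, sub_zero]
          · rwa [happ k0 hk0]
          · intro j hj
            rw [happ j (by omega), hlow j hj]
          · intro l hl
            rw [tau_add_single _ (hl.trans hk.symm)]
            have h1 := hM k hk
            have h2 := hmax l hl
            push_cast at h1
            split_ifs with hlk hlk'
            · have := hmin l hlk hl
              omega
            · omega
            · omega
    intro z hz hn
    by_cases hneg : ∀ k ≤ 0, z k = 0
    · exact Reaches.refl ⟨z, rfl, hz, hneg⟩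
    · push Not at hneg
      obtain ⟨N, hN⟩ := exists_support_bound (reflect z)
      obtain ⟨k0, ⟨hk0, hne⟩, hmin⟩ := Int.exists_least_of_bdd
        (P := fun k => k ≤ 0 ∧ z k ≠ 0) ⟨-N, fun k hk => by
          by_contra hkN
          have := hN (-k) (by omega)
          rw [reflect_apply, neg_neg] at this
          exact hk.2 this⟩ hneg
      obtain ⟨B, hB⟩ := exists_tau_le (a1 := a1) (a2 := a2) (lamW (p 1) (p 0)) z (idx k0)
      refine key B.toNat z hz (by simpa using hn) k0 hk0
        (lt_of_le_of_ne (hz.nonpos hk0) hne) (fun j hj => ?_)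
        (fun l hl => (hB l hl).trans (Int.self_le_toNat B))
      by_contra hj0
      exact absurd (hmin j ⟨by omega, hj0⟩) hj.not_ge

theorem Bounded.sigmaCond {k1 k2 : ℤ} {z : ℤ → ℤ}
    (h : Bounded a1 a2 (pseq a1 a2 k1 k2) (shifted (pseq a1 a2 k1 k2) z)) :
    SigmaCond a1 a2 k1 k2 z := by
  generalize hpq : pseq a1 a2 k1 k2 = p at h
  have hpos : ∀ {k}, 1 ≤ k → shifted p z k = z k := fun hk => if_pos hk
  have hneg : ∀ {k}, k ≤ 0 → shifted p z k = z k + p k := fun hk => if_neg (by omega)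
  rw [SigmaCond, hpq]
  refine ⟨?_, ?_, fun k hk => ?_, fun k hk => ?_, fun k hk => ?_, fun k hk => ?_, fun k hk => ?_,
    fun k hk => ?_⟩
  · have := h.le_mul 0
    rw [hneg le_rfl, hpos (by norm_num), zero_add] at this
    push_cast at this
    linarith
  · have := h.sub_le_mul 0
    rw [hneg le_rfl, hpos (by norm_num), zero_add] at this
    push_cast at this
    linarith
  · have := h.le k
    rw [hpos hk] at this
    rw [sub_nonneg]
    exact_mod_cast this
  · have := h.le_mul k
    rw [hpos hk, hpos (by omega)] at this
    linarith
  · have := h.sub_le_mul k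
    rw [hpos hk, hpos (by omega)] at this
    linarith
  · have := h.nonneg k
    rw [hneg hk, add_comm] at this
    exact_mod_cast this
  · have := h.sub_le_mul (k - 1)
    rw [sub_add_cancel, hneg hk, hneg (by omega)] at this
    push_cast at this
    linarith
  · have := h.le_mul (k - 1)
    rw [sub_add_cancel, hneg hk, hneg (by omega)] at this
    push_cast at this
    linarith

theorem Bounded.sigmaPrimeMem (ha : Hyperbolic a1 a2) {k1 k2 : ℤ} {z : ℤ →₀ ℤ}
    (h : Bounded a1 a2 (pseq a1 a2 k1 k2) (shifted (pseq a1 a2 k1 k2) z))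
    (h0 : ∀ k ≤ 0, z k = 0) : SigmaPrimeMem a1 a2 k1 k2 z := by
  have hpos : ∀ {k}, 1 ≤ k → shifted (pseq a1 a2 k1 k2) z k = z k := fun hk => if_pos hk
  have hplus : ZPlusMem (posPart z) := by
    refine ⟨fun k hk => if_neg (by omega), fun k => ?_, ?_⟩
    · unfold posPart
      split_ifs with hk
      · rw [← hpos hk]
        exact h.nonneg k
      · exact le_rfl
    · obtain ⟨N, hN⟩ := exists_support_bound z
      refine ⟨N.toNat, fun k hk => ?_⟩
      rw [posPart, hN k (by omega), ite_self]
  have hminus : negPart z = 0 := by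
    ext k
    unfold negPart
    split_ifs with hk
    · exact h0 k hk
    · rfl
  refine ⟨⟨⟨hplus, ?_⟩, h.sigmaCond⟩, h0, hplus, fun j hj => ?_⟩
  · rw [hminus]
    exact ⟨fun _ _ => rfl, fun _ => le_rfl, 0, fun _ _ => rfl⟩
  · obtain ⟨n, rfl⟩ : ∃ n : ℕ, j = n + 1 := ⟨(j - 1).toNat, by omega⟩
    have h1 := h.le_mul (n + 1)
    rw [hpos hj, hpos (by omega)] at h1
    have h2 := (ha.cgen_growth 0 n).2
    rw [zero_add] at h2
    have h3 : (0 : ℝ) ≤ cgen a1 a2 0 n := by exact_mod_cast ha.cgen_nonneg 0 n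
    have h4 : (0 : ℝ) ≤ z (n + 1) := by
      have := h.nonneg (n + 1)
      rw [hpos hj] at this
      exact_mod_cast this
    have h5 : (cgen a1 a2 0 n * z (n + 1 + 1) : ℝ) ≤ cgen a1 a2 0 (n + 1) * z (n + 1) :=
      calc (cgen a1 a2 0 n * z (n + 1 + 1) : ℝ)
          ≤ cgen a1 a2 0 n * (gammaR a1 a2 (n + 1) * z (n + 1)) :=
            mul_le_mul_of_nonneg_left h1 h3
        _ = gammaR a1 a2 (n + 1) * cgen a1 a2 0 n * z (n + 1) := by ring
        _ ≤ _ := mul_le_mul_of_nonneg_right h2 h4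
    rw [show ((n : ℤ) + 1).toNat = n + 1 by omega, show ((n : ℤ) + 1 - 1).toNat = n by omega,
      ← cgen_zero_eq, ← cgen_zero_eq, posPart, if_pos hj, posPart, if_pos (by omega), sub_nonneg]
    exact_mod_cast h5

theorem XXMem.exists_coe {y : ℤ → ℤ} (hy : XXMem a1 a2 y) : ∃ z : ℤ →₀ ℤ, (z : ℤ → ℤ) = y := by
  obtain ⟨Y, hY, -⟩ := hy.1.exists_cone
  obtain ⟨D, hD, -⟩ := hy.2.exists_cone
  refine ⟨Y + -reflect D, ?_⟩
  rw [Finsupp.coe_add, hY, hD]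
  ext k
  rw [Pi.add_apply, posPart, negPart]
  split_ifs <;> omega

end HypCrystal

open HypCrystal in
theorem extremal_connects_to_sigmaPrime
    (a1 a2 : ℤ) (ha1 : 1 ≤ a1) (ha2 : 1 ≤ a2) (ha : 4 < a1 * a2)
    (k1 k2 : ℤ) (hk1 : 0 < k1) (hk2 : 0 < k2)
    (hreg : 2 ≤ a1 → 2 ≤ a2 →
      (k2 ≤ k1 ∧ k1 < (a1 - 1) * k2) ∨ (k1 < k2 ∧ k2 ≤ (a2 - 1) * k1))
    (hdeg1 : a1 = 1 → 2 * k1 ≤ k2 ∧ k2 ≤ (a2 - 2) * k1)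
    (hdeg2 : a2 = 1 → 2 * k2 ≤ k1 ∧ k1 ≤ (a1 - 2) * k2)
    (y : ℤ → ℤ) (hy : XXMem a1 a2 y)
    (hext : Extremal a1 a2 (mustar a1 a2 (lamW k1 k2) y) (xstarFun a1 a2 y)) :
    ∃ js : List ℤ, (∀ j ∈ js, IsI j) ∧
      ∃ z : ℤ → ℤ,
        js.foldl (fun ob j => ob.bind (fZ a1 a2 (lamW k1 k2) j)) (some y) = some z ∧
        SigmaPrimeMem a1 a2 k1 k2 z := by
  have hA : Hyperbolic a1 a2 := ⟨ha1, ha2, ha⟩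
  have hrec := pseq_recurrence (a1 := a1) (a2 := a2) k1 k2
  have hpos : ∀ k, 0 < pseq a1 a2 k1 k2 k :=
    recurrence_pos hrec hA hk2 hk1 hreg hdeg1 hdeg2
  have hb : Bounded a1 a2 (pseq a1 a2 k1 k2) (shifted (pseq a1 a2 k1 k2) y) :=
    hext.bounded hA hpos hrec hy
  obtain ⟨Z, rfl⟩ := hy.exists_coe
  obtain ⟨js, hjs, z, hz, Z', rfl, hZ', h0⟩ :=
    hb.reaches hA hrec ((depth Z).toNat + 1) Z (by have := Int.self_le_toNat (depth Z); omega)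
  exact ⟨js, hjs, Z', hz, hZ'.sigmaPrimeMem hA h0⟩
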